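/- arXiv:2010.12167 — 12 statements merged into one kernel-verified Lean document; each statement's English description precedes it below -/
import Mathlib

section
/- Suppose (K, Ω) has infinite smoothness. Then there exist constants Ĉ₁, Ĉ₂ > 0, depending only on d, K, and Ω, such that for every subset Ω̂ ⊆ Ω, every P-greedy sequence ξ₁, ξ₂, … for (K, Ω̂), and every n ∈ ℤ_{>0}, one has sup_{x ∈ Ω̂} P_{(ξ₁,…,ξ_n)}(x) < Ĉ₁ · exp(−Ĉ₂ · n^{1/d}). -/
open Matrix

/-- The power function `P_X(x) = sqrt (K(x,x) - k_X(x)ᵀ K_X⁻¹ k_X(x))` of a kernel `K`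
relative to the finite tuple of points `X`.  For the empty tuple it is `sqrt (K(x,x))`. -/
noncomputable def powerFunction {Ω : Type*} (K : Ω → Ω → ℝ) {n : ℕ}
    (X : Fin n → Ω) (x : Ω) : ℝ :=
  Real.sqrt (K x x -
    (fun i => K x (X i)) ⬝ᵥ ((Matrix.of fun i j => K (X i) (X j))⁻¹ *ᵥ fun i => K x (X i)))

/-- `ξ₁, ξ₂, …` is a `P`-greedy sequence for `(K, S)`: a sequence of pairwise distinct
points of `S` such that `K(ξ₁, ξ₁) = sup_{x ∈ S} K(x,x)` and, for every `m ≥ 1`,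
`P_{(ξ₁,…,ξ_m)}(ξ_{m+1}) = sup_{x ∈ S} P_{(ξ₁,…,ξ_m)}(x)` (the suprema are attained). -/
def IsPGreedySeq {Ω : Type*} (K : Ω → Ω → ℝ) (S : Set Ω) (ξ : ℕ → Ω) : Prop :=
  (∀ n, ξ n ∈ S) ∧ Function.Injective ξ ∧
    (∀ x ∈ S, K x x ≤ K (ξ 0) (ξ 0)) ∧
    ∀ m : ℕ, 0 < m → ∀ x ∈ S,
      powerFunction K (fun i : Fin m => ξ i.1) x ≤
        powerFunction K (fun i : Fin m => ξ i.1) (ξ m)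


/-- A determinant is at most `n!` times the product of bounds on its rows. -/
lemma abs_det_le_factorial_mul_prod {n : ℕ} (A : Matrix (Fin n) (Fin n) ℝ) (b : Fin n → ℝ)
    (h : ∀ i j, |A i j| ≤ b i) : |A.det| ≤ (n.factorial : ℝ) * ∏ i, b i := by
  rw [Matrix.det_apply]
  calc |∑ σ : Equiv.Perm (Fin n), Equiv.Perm.sign σ • ∏ i, A (σ i) i|
      ≤ ∑ σ : Equiv.Perm (Fin n), |Equiv.Perm.sign σ • ∏ i, A (σ i) i| :=
        Finset.abs_sum_le_sum_abs _ _
    _ ≤ ∑ _σ : Equiv.Perm (Fin n), ∏ i, b i := by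
        refine Finset.sum_le_sum fun σ _ => ?_
        have h1 : |Equiv.Perm.sign σ • ∏ i, A (σ i) i| = |∏ i, A (σ i) i| := by
          rcases Int.units_eq_one_or (Equiv.Perm.sign σ) with h | h <;> simp [h]
        rw [h1, Finset.abs_prod, ← Equiv.prod_comp σ b]
        exact Finset.prod_le_prod (fun _ _ => abs_nonneg _) fun i _ => h _ _
    _ = _ := by simp [Fintype.card_perm]

/-- The determinant of a small perturbation of a matrix of low rank is small. -/
lemma abs_det_mul_add_le {n : ℕ} {T : Type*} [Fintype T]
    (A : Matrix (Fin n) T ℝ) (B : Matrix T (Fin n) ℝ) (E : Matrix (Fin n) (Fin n) ℝ)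
    {c ε : ℝ} (hc : 1 ≤ c) (hε0 : 0 ≤ ε) (hε1 : ε ≤ 1)
    (hAB : ∀ i j, |(A * B) i j| ≤ c) (hE : ∀ i j, |E i j| ≤ ε) :
    |(A * B + E).det| ≤ 2 ^ n * (n.factorial * (c ^ n * ε ^ (n - Fintype.card T))) := by
  classical
  have hexp : (A * B + E).det
      = ∑ s : Finset (Fin n), Matrix.det (Matrix.of (s.piecewise (A * B).row E.row)) :=
    (Matrix.detRowAlternating (R := ℝ) (n := Fin n)).toMultilinearMap.map_add_univ
      (A * B).row E.row
  have hterm : ∀ s : Finset (Fin n),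
      |Matrix.det (Matrix.of (s.piecewise (A * B).row E.row))|
        ≤ n.factorial * (c ^ n * ε ^ (n - Fintype.card T)) := by
    intro s
    by_cases hs : s.card ≤ Fintype.card T
    · refine (abs_det_le_factorial_mul_prod _ (s.piecewise (fun _ => c) fun _ => ε) ?_).trans ?_
      · intro i j
        by_cases hi : i ∈ s
        · rw [Matrix.of_apply, Finset.piecewise_eq_of_mem _ _ _ hi,
            Finset.piecewise_eq_of_mem _ _ _ hi]
          exact hAB i j
        · rw [Matrix.of_apply, Finset.piecewise_eq_of_notMem _ _ _ hi,
            Finset.piecewise_eq_of_notMem _ _ _ hi]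
          exact hE i j
      · rw [Finset.prod_piecewise]
        simp only [Finset.univ_inter, Finset.prod_const]
        gcongr ?_ * (?_ * ?_)
        · exact pow_le_pow_right₀ hc (by simpa using s.card_le_univ)
        · refine pow_le_pow_of_le_one hε0 hε1 ?_
          rw [← Finset.compl_eq_univ_sdiff, Finset.card_compl, Fintype.card_fin]
          omega
    · have hdep : ¬ LinearIndependent ℝ (s.piecewise (A * B).row E.row) := by
        intro hli
        have h1 : LinearIndependent ℝ (fun i : s => (A * B).row i) := by
          have := hli.comp (fun i : s => (i : Fin n)) Subtype.val_injective
          convert this using 1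
          ext i j
          simp
        have h2 : s.card = ((A * B).submatrix (fun i : s => (i : Fin n)) id).rank := by
          have h := LinearIndependent.rank_matrix
            (M := (A * B).submatrix (fun i : s => (i : Fin n)) id) h1
          rw [h, Fintype.card_coe]
        have h3 : (A * B).submatrix (fun i : s => (i : Fin n)) id
            = A.submatrix (fun i : s => (i : Fin n)) id * B := rfl
        rw [h3] at h2
        exact hs (h2.trans_le ((Matrix.rank_mul_le_left _ _).trans (Matrix.rank_le_card_width _)))
      have h0 : Matrix.det (Matrix.of (s.piecewise (A * B).row E.row)) = 0 :=
        (Matrix.detRowAlternating (R := ℝ) (n := Fin n)).map_linearDependent _ hdep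
      rw [h0, abs_zero]
      positivity
  rw [hexp]
  calc _ ≤ ∑ s : Finset (Fin n), |Matrix.det (Matrix.of (s.piecewise (A * B).row E.row))| :=
        Finset.abs_sum_le_sum_abs _ _
    _ ≤ ∑ _s : Finset (Fin n), _ := Finset.sum_le_sum fun s _ => hterm s
    _ = _ := by simp


lemma two_mul_dotProduct_sub_le {n : ℕ} {A : Matrix (Fin n) (Fin n) ℝ} (hA : A.PosDef)
    (k c : Fin n → ℝ) : 2 * (c ⬝ᵥ k) - c ⬝ᵥ (A *ᵥ c) ≤ k ⬝ᵥ (A⁻¹ *ᵥ k) := by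
  have hdet : IsUnit A.det := (Matrix.isUnit_iff_isUnit_det _).1 hA.isUnit
  have h := hA.posSemidef.dotProduct_mulVec_nonneg (c - A⁻¹ *ᵥ k)
  have hT : Aᵀ = A := by simpa [Matrix.IsSymm] using hA.isHermitian
  have h1 : A *ᵥ (A⁻¹ *ᵥ k) = k := by
    rw [Matrix.mulVec_mulVec, Matrix.mul_nonsing_inv _ hdet, Matrix.one_mulVec]
  have h2 : (A⁻¹ *ᵥ k) ⬝ᵥ (A *ᵥ c) = c ⬝ᵥ k := by
    rw [Matrix.dotProduct_mulVec, ← Matrix.mulVec_transpose, hT, h1, dotProduct_comm]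
  rw [star_trivial, Matrix.mulVec_sub, h1, sub_dotProduct, dotProduct_sub, dotProduct_sub, h2,
    dotProduct_comm (A⁻¹ *ᵥ k) k] at h
  linarith

/-- Adding a point to the tuple decreases the power function. -/
lemma powerFunction_succ_le {Ω : Type*} (K : Ω → Ω → ℝ) (ξ : ℕ → Ω) (m : ℕ)
    (h0 : (Matrix.of fun i j : Fin m => K (ξ i) (ξ j)).PosDef)
    (h1 : (Matrix.of fun i j : Fin (m + 1) => K (ξ i) (ξ j)).PosDef) (x : Ω) :
    powerFunction K (fun i : Fin (m + 1) => ξ i.1) x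
      ≤ powerFunction K (fun i : Fin m => ξ i.1) x := by
  unfold powerFunction
  refine Real.sqrt_le_sqrt (sub_le_sub_left ?_ _)
  set A := Matrix.of fun i j : Fin m => K (ξ i) (ξ j) with hAdef
  set k : Fin m → ℝ := fun i => K x (ξ i) with hk
  have hdet : IsUnit A.det := (Matrix.isUnit_iff_isUnit_det _).1 h0.isUnit
  have hAk : A *ᵥ (A⁻¹ *ᵥ k) = k := by
    rw [Matrix.mulVec_mulVec, Matrix.mul_nonsing_inv _ hdet, Matrix.one_mulVec]
  set c := A⁻¹ *ᵥ k with hc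
  have h := two_mul_dotProduct_sub_le h1 (fun i => K x (ξ i)) (Fin.snoc (α := fun _ => ℝ) c 0)
  refine le_trans (le_of_eq ?_) h
  have e1 : (Fin.snoc (α := fun _ => ℝ) c 0) ⬝ᵥ (fun i : Fin (m + 1) => K x (ξ i)) = c ⬝ᵥ k := by
    simp [dotProduct, Fin.sum_univ_castSucc, hk]
  have e2 : (Fin.snoc (α := fun _ => ℝ) c 0) ⬝ᵥ
      ((Matrix.of fun i j : Fin (m + 1) => K (ξ i) (ξ j)) *ᵥ Fin.snoc (α := fun _ => ℝ) c 0)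
      = c ⬝ᵥ (A *ᵥ c) := by
    simp [dotProduct, Matrix.mulVec, Fin.sum_univ_castSucc, hAdef]
  rw [e1, e2, hAk, dotProduct_comm k c]
  ring

/-- Recursive formula for the determinants of kernel matrices. -/
lemma det_kernel_succ {Ω : Type*} (K : Ω → Ω → ℝ) (hsym : ∀ x y, K x y = K y x) (ξ : ℕ → Ω) (m : ℕ)
    (h0 : (Matrix.of fun i j : Fin m => K (ξ i) (ξ j)).PosDef)
    (h1 : (Matrix.of fun i j : Fin (m + 1) => K (ξ i) (ξ j)).PosDef) :
    (Matrix.of fun i j : Fin (m + 1) => K (ξ i) (ξ j)).det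
      = (Matrix.of fun i j : Fin m => K (ξ i) (ξ j)).det *
        powerFunction K (fun i : Fin m => ξ i.1) (ξ m) ^ 2 := by
  set A := Matrix.of fun i j : Fin m => K (ξ i) (ξ j) with hAdef
  set k : Fin m → ℝ := fun i => K (ξ m) (ξ i) with hk
  have hdet : IsUnit A.det := (Matrix.isUnit_iff_isUnit_det _).1 h0.isUnit
  let _ : Invertible A := A.invertibleOfIsUnitDet hdet
  have hblock : (Matrix.of fun i j : Fin (m + 1) => K (ξ i) (ξ j)).submatrix
      finSumFinEquiv finSumFinEquiv = Matrix.fromBlocks A (Matrix.of fun i _ => k i)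
        (Matrix.of fun (_ : Fin 1) j => k j) (Matrix.of fun _ _ => K (ξ m) (ξ m)) := by
    ext i j
    rcases i with i | i <;> rcases j with j | j <;> simp [hAdef, hk, hsym]
  have hschur : (Matrix.of fun i j : Fin (m + 1) => K (ξ i) (ξ j)).det
      = A.det * (K (ξ m) (ξ m) - k ⬝ᵥ (A⁻¹ *ᵥ k)) := by
    rw [← Matrix.det_submatrix_equiv_self finSumFinEquiv, hblock, Matrix.det_fromBlocks₁₁,
      Matrix.det_unique (n := Fin 1), Matrix.invOf_eq_nonsing_inv, Matrix.mul_assoc]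
    rfl
  have hpos : 0 < K (ξ m) (ξ m) - k ⬝ᵥ (A⁻¹ *ᵥ k) := by
    have := h1.det_pos
    rw [hschur] at this
    exact (mul_pos_iff_of_pos_left h0.det_pos).1 this
  rw [hschur, powerFunction, Real.sq_sqrt hpos.le]

lemma powerFunction_le_of_le {Ω : Type*} (K : Ω → Ω → ℝ) (ξ : ℕ → Ω)
    (hpd : ∀ n : ℕ, (Matrix.of fun i j : Fin n => K (ξ i) (ξ j)).PosDef) {m n : ℕ} (hmn : m ≤ n)
    (x : Ω) : powerFunction K (fun i : Fin n => ξ i.1) x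
      ≤ powerFunction K (fun i : Fin m => ξ i.1) x :=
  antitone_nat_of_succ_le (f := fun n => powerFunction K (fun i : Fin n => ξ i.1) x)
    (fun m => powerFunction_succ_le K ξ m (hpd m) (hpd (m + 1)) x) hmn

lemma powerFunction_zero {Ω : Type*} (K : Ω → Ω → ℝ) (X : Fin 0 → Ω) (x : Ω) :
    powerFunction K X x = Real.sqrt (K x x) := by
  simp [powerFunction]

/-- Along a `P`-greedy sequence the maximum of the power function is controlled by the
determinants of the kernel matrices. -/
lemma IsPGreedySeq.powerFunction_pow_le_det {Ω : Type*} {K : Ω → Ω → ℝ}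
    (hsym : ∀ x y, K x y = K y x) {S : Set Ω} {ξ : ℕ → Ω} (hξ : IsPGreedySeq K S ξ)
    (hpd : ∀ n : ℕ, (Matrix.of fun i j : Fin n => K (ξ i) (ξ j)).PosDef) (n : ℕ) :
    ∀ m ≤ n, powerFunction K (fun i : Fin n => ξ i.1) (ξ n) ^ (2 * m)
      ≤ (Matrix.of fun i j : Fin m => K (ξ i) (ξ j)).det := by
  have hmax : ∀ m, ∀ x ∈ S, powerFunction K (fun i : Fin m => ξ i.1) x
      ≤ powerFunction K (fun i : Fin m => ξ i.1) (ξ m) := by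
    intro m x hx
    rcases Nat.eq_zero_or_pos m with rfl | hm
    · rw [powerFunction_zero, powerFunction_zero]
      exact Real.sqrt_le_sqrt (hξ.2.2.1 x hx)
    · exact hξ.2.2.2 m hm x hx
  intro m
  induction m with
  | zero => simp
  | succ m ih =>
    intro hm
    rw [det_kernel_succ K hsym ξ m (hpd m) (hpd (m + 1)), Nat.mul_succ, pow_add]
    gcongr
    · exact (hpd m).det_pos.le
    · exact ih (by omega)
    · exact Real.sqrt_nonneg _
    · exact (powerFunction_le_of_le K ξ hpd (by omega) _).trans (hmax m _ (hξ.1 n))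

/-- Local polynomial approximation of functions with factorially bounded derivatives. -/
lemma exists_taylor_coeff_of_iteratedDerivWithin_le {f : ℝ → ℝ} {l₀ : ℕ} {M : ℝ} (hM : 0 < M)
    (hf : ContDiffOn ℝ (⊤ : ℕ∞) f (Set.Ici 0))
    (hbd : ∀ l : ℕ, l₀ ≤ l → ∀ r : ℝ, 0 ≤ r →
      |iteratedDerivWithin l f (Set.Ici 0) r| ≤ (l.factorial : ℝ) * M ^ l)
    {L : ℕ} (hL : 0 < L) (hl₀ : l₀ ≤ L) {a : ℝ} (ha : 0 ≤ a) :
    ∃ c : ℕ → ℝ, ∀ r ∈ Set.Icc a (a + 1 / (4 * M)),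
      |f r - ∑ k ∈ Finset.range L, c k * (r - a) ^ k| ≤ (1 / 2) ^ L := by
  obtain ⟨n, rfl⟩ : ∃ n, L = n + 1 := ⟨L - 1, by omega⟩
  set b := a + 1 / (4 * M) with hb
  have hab : a < b := by rw [hb]; simp only [lt_add_iff_pos_right]; positivity
  have hsub : Set.Icc a b ⊆ Set.Ici 0 := fun x hx => ha.trans hx.1
  have hfn : ContDiffOn ℝ ((n + 1 : ℕ) : WithTop ℕ∞) f (Set.Ici 0) :=
    hf.of_le (by exact_mod_cast le_top)
  refine ⟨fun k => (k.factorial : ℝ)⁻¹ * iteratedDerivWithin k f (Set.Icc a b) a, fun r hr => ?_⟩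
  have hC : ∀ y ∈ Set.Icc a b, ‖iteratedDerivWithin (n + 1) f (Set.Icc a b) y‖
      ≤ ((n + 1).factorial : ℝ) * M ^ (n + 1) := by
    intro y hy
    have : iteratedDerivWithin (n + 1) f (Set.Icc a b) y
        = iteratedDerivWithin (n + 1) f (Set.Ici 0) y := by
      simp only [iteratedDerivWithin]
      rw [iteratedFDerivWithin_subset hsub (uniqueDiffOn_Icc hab) (uniqueDiffOn_Ici 0) hfn hy]
    rw [this]
    exact hbd _ hl₀ y (hsub hy)
  have h := taylor_mean_remainder_bound hab.le (by exact_mod_cast hfn.mono hsub) hr hC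
  rw [taylor_within_apply, Real.norm_eq_abs] at h
  have hsum : ∑ k ∈ Finset.range (n + 1),
        ((k.factorial : ℝ)⁻¹ * iteratedDerivWithin k f (Set.Icc a b) a) * (r - a) ^ k
      = ∑ k ∈ Finset.range (n + 1),
        ((k.factorial : ℝ)⁻¹ * (r - a) ^ k) • iteratedDerivWithin k f (Set.Icc a b) a :=
    Finset.sum_congr rfl fun k _ => by rw [smul_eq_mul]; ring
  rw [hsum]
  refine h.trans ?_
  have hra : 0 ≤ r - a := sub_nonneg.2 hr.1
  have hMr : M * (r - a) ≤ 1 / 4 := by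
    have : r - a ≤ 1 / (4 * M) := by linarith [hr.2]
    calc M * (r - a) ≤ M * (1 / (4 * M)) := by gcongr
      _ = 1 / 4 := by field_simp
  have hfac : ((n + 1).factorial : ℝ) = (n + 1) * n.factorial := by
    rw [Nat.factorial_succ]; push_cast; ring
  have hn0 : (n.factorial : ℝ) ≠ 0 := by positivity
  have htwo : ((n : ℝ) + 1) ≤ 2 ^ (n + 1) := by
    exact_mod_cast (Nat.lt_two_pow_self (n := n + 1)).le
  calc ((n + 1).factorial : ℝ) * M ^ (n + 1) * (r - a) ^ (n + 1) / n.factorial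
      = (n + 1) * (M * (r - a)) ^ (n + 1) := by
        rw [hfac, mul_pow]; field_simp
    _ ≤ 2 ^ (n + 1) * (1 / 4) ^ (n + 1) := by gcongr
    _ = (1 / 2) ^ (n + 1) := by rw [← mul_pow]; norm_num

/-- The monomial functions with all exponents less than `N`. -/
noncomputable def monomialFunction (d N : ℕ) (α : Fin d → Fin N) (x : EuclideanSpace ℝ (Fin d)) : ℝ :=
  ∏ i, x i ^ (α i : ℕ)

/-- Polynomials of total degree less than `N` are combinations of monomials with exponents
less than `N`. -/
lemma eval_mem_span_monomialFunction {d N : ℕ} (p : MvPolynomial (Fin d) ℝ)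
    (hp : p.totalDegree < N) :
    (fun x : EuclideanSpace ℝ (Fin d) => MvPolynomial.eval (fun i => x i) p)
      ∈ Submodule.span ℝ (Set.range (monomialFunction d N)) := by
  have h : (fun x : EuclideanSpace ℝ (Fin d) => MvPolynomial.eval (fun i => x i) p)
      = ∑ m ∈ p.support, p.coeff m • fun x : EuclideanSpace ℝ (Fin d) => ∏ i, x i ^ m i := by
    ext x
    rw [MvPolynomial.eval_eq', Finset.sum_apply]
    rfl
  rw [h]
  refine Submodule.sum_mem _ fun m hm => Submodule.smul_mem _ _ (Submodule.subset_span ?_)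
  have hlt : ∀ i, m i < N := fun i =>
    (((Finset.single_le_sum (fun _ _ => Nat.zero_le _) (Finset.mem_univ i)).trans_eq
      (Finsupp.sum_fintype m (fun _ e => e) fun _ => rfl).symm).trans
        (MvPolynomial.le_totalDegree hm)).trans_lt hp
  exact ⟨fun i => ⟨m i, hlt i⟩, rfl⟩

/-- Polynomials in the squared distance are combinations of monomials. -/
lemma exists_sum_monomialFunction_eq {d : ℕ} (L : ℕ) (y : EuclideanSpace ℝ (Fin d)) (a : ℝ)
    (c : ℕ → ℝ) : ∃ β : (Fin d → Fin (2 * L)) → ℝ, ∀ x : EuclideanSpace ℝ (Fin d),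
      ∑ k ∈ Finset.range L, c k * (‖x - y‖ ^ 2 - a) ^ k
        = ∑ α, β α * monomialFunction d (2 * L) α x := by
  have hmem : (fun x : EuclideanSpace ℝ (Fin d) =>
      ∑ k ∈ Finset.range L, c k * (‖x - y‖ ^ 2 - a) ^ k)
        ∈ Submodule.span ℝ (Set.range (monomialFunction d (2 * L))) := by
    set s : MvPolynomial (Fin d) ℝ :=
      ∑ i, (MvPolynomial.X i - MvPolynomial.C (y i)) ^ 2 - MvPolynomial.C a with hs
    have hsd : s.totalDegree ≤ 2 := by
      refine (MvPolynomial.totalDegree_sub_C_le _ _).trans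
        (MvPolynomial.totalDegree_finsetSum_le fun i _ => ?_)
      refine (MvPolynomial.totalDegree_pow _ _).trans ?_
      have := MvPolynomial.totalDegree_sub_C_le (MvPolynomial.X i : MvPolynomial (Fin d) ℝ) (y i)
      rw [MvPolynomial.totalDegree_X] at this
      omega
    have hse : ∀ x : EuclideanSpace ℝ (Fin d),
        MvPolynomial.eval (fun i => x i) s = ‖x - y‖ ^ 2 - a := by
      intro x
      simp [hs, EuclideanSpace.norm_sq_eq]
    have heq : (fun x : EuclideanSpace ℝ (Fin d) =>
        ∑ k ∈ Finset.range L, c k * (‖x - y‖ ^ 2 - a) ^ k)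
        = ∑ k ∈ Finset.range L, c k • fun x : EuclideanSpace ℝ (Fin d) =>
          MvPolynomial.eval (fun i => x i) (s ^ k) := by
      ext x
      simp [hse]
    rw [heq]
    refine Submodule.sum_mem _ fun k hk => Submodule.smul_mem _ _
      (eval_mem_span_monomialFunction _ ?_)
    have := Finset.mem_range.1 hk
    have h2 := MvPolynomial.totalDegree_pow s k
    have h3 := Nat.mul_le_mul_left k hsd
    omega
  obtain ⟨β, hβ⟩ := (Submodule.mem_span_range_iff_exists_fun ℝ).1 hmem
  refine ⟨β, fun x => ?_⟩
  have := congrFun hβ x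
  simpa using this.symm

/-- Kernel matrices of radial kernels with factorially bounded derivatives are exponentially
close to matrices of low rank. -/
lemma exists_low_rank_approx {d : ℕ} {S : Set (EuclideanSpace ℝ (Fin d))} (hS : S.Nonempty)
    (hSb : Bornology.IsBounded S) {f : ℝ → ℝ} {l₀ : ℕ} {M : ℝ} (hM : 0 < M)
    (hf : ContDiffOn ℝ (⊤ : ℕ∞) f (Set.Ici 0))
    (hbd : ∀ l : ℕ, l₀ ≤ l → ∀ r : ℝ, 0 ≤ r →
      |iteratedDerivWithin l f (Set.Ici 0) r| ≤ (l.factorial : ℝ) * M ^ l) :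
    ∃ Q : ℕ, 0 < Q ∧ ∀ L : ℕ, 0 < L → l₀ ≤ L →
      ∀ (n : ℕ) (x : Fin n → EuclideanSpace ℝ (Fin d)), (∀ i, x i ∈ S) →
        ∃ (A : Matrix (Fin n) (Fin Q × (Fin d → Fin (2 * L))) ℝ)
          (B : Matrix (Fin Q × (Fin d → Fin (2 * L))) (Fin n) ℝ),
          ∀ i j, |f (‖x i - x j‖ ^ 2) - (A * B) i j| ≤ (1 / 2) ^ L := by
  obtain ⟨D, hD⟩ := Metric.isBounded_iff.1 hSb
  have hD0 : 0 ≤ D := by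
    obtain ⟨z, hz⟩ := hS
    simpa using hD hz hz
  set h := 1 / (4 * M) with hh
  have hhpos : 0 < h := by positivity
  set δ := min 1 (h / (4 * (D + 1))) with hδ
  have hδpos : 0 < δ := by positivity
  have hδ1 : δ ≤ 1 := min_le_left _ _
  have hδh : δ * (2 * (D + 1)) ≤ h / 2 := by
    calc δ * (2 * (D + 1)) ≤ h / (4 * (D + 1)) * (2 * (D + 1)) := by
          gcongr
          exact min_le_right _ _
      _ = h / 2 := by field_simp; norm_num
  obtain ⟨t, htf, ht⟩ := Metric.totallyBounded_iff.1
    (hSb.isCompact_closure.totallyBounded.subset subset_closure) δ hδpos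
  obtain ⟨Q, ⟨e⟩⟩ : ∃ Q, Nonempty (Fin Q ≃ t) :=
    have := htf.to_subtype
    ⟨Nat.card t, ⟨(Finite.equivFin t).symm⟩⟩
  have hcover : ∀ x ∈ S, ∃ q : Fin Q, dist x (e q).1 < δ := by
    intro x hx
    obtain ⟨y, hy, hxy⟩ := Set.mem_iUnion₂.1 (ht hx)
    exact ⟨e.symm ⟨y, hy⟩, by rw [Equiv.apply_symm_apply]; exact hxy⟩
  have hQ : 0 < Q := by
    obtain ⟨z, hz⟩ := hS
    exact (hcover z hz).choose.pos
  refine ⟨Q, hQ, fun L hL hl n x hx => ?_⟩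
  choose q hq using fun i => hcover (x i) (hx i)
  let a : Fin Q → Fin n → ℝ := fun p j =>
    max 0 (‖(e p).1 - x j‖ ^ 2 - h / 2)
  choose c hc using fun p j =>
    exists_taylor_coeff_of_iteratedDerivWithin_le hM hf hbd hL hl (le_max_left _ _ : 0 ≤ a p j)
  choose β hβ using fun p j => exists_sum_monomialFunction_eq L (x j) (a p j) (c p j)
  let A : Matrix (Fin n) (Fin Q × (Fin d → Fin (2 * L))) ℝ :=
    Matrix.of fun i p => if q i = p.1 then monomialFunction d (2 * L) p.2 (x i) else 0
  let B : Matrix (Fin Q × (Fin d → Fin (2 * L))) (Fin n) ℝ := Matrix.of fun p j => β p.1 j p.2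
  refine ⟨A, B, fun i j => ?_⟩
  have hprod : (A * B) i j
      = ∑ k ∈ Finset.range L, c (q i) j k * (‖x i - x j‖ ^ 2 - a (q i) j) ^ k := by
    rw [hβ, Matrix.mul_apply, Fintype.sum_prod_type]
    simp only [A, B, Matrix.of_apply, ite_mul, zero_mul]
    rw [Finset.sum_eq_single (q i) (fun b _ hb => by simp [hb.symm]) (by simp)]
    simp [mul_comm]
  rw [hprod]
  refine hc (q i) j _ ?_
  have hdist : |‖x i - x j‖ ^ 2 - ‖(e (q i)).1 - x j‖ ^ 2| ≤ h / 2 := by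
    set u := ‖x i - x j‖ with hu
    set v := ‖(e (q i)).1 - x j‖ with hv
    have huv : |u - v| ≤ δ := by
      refine (abs_norm_sub_norm_le _ _).trans ?_
      rw [sub_sub_sub_cancel_right, ← dist_eq_norm]
      exact (hq i).le
    have huD : u ≤ D := by
      rw [hu, ← dist_eq_norm]
      exact hD (hx i) (hx j)
    have hu0 : 0 ≤ u := norm_nonneg _
    have hv0 : 0 ≤ v := norm_nonneg _
    have hvu : v ≤ D + 1 := by
      have := (abs_le.1 huv).1
      linarith
    calc |u ^ 2 - v ^ 2| = |u - v| * (u + v) := by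
          rw [← abs_of_nonneg (add_nonneg hu0 hv0), ← abs_mul]
          ring_nf
      _ ≤ δ * (2 * (D + 1)) := by
          gcongr
          linarith
      _ ≤ h / 2 := hδh
  have h1 := abs_le.1 hdist
  have h2 : ‖(e (q i)).1 - x j‖ ^ 2 - h / 2 ≤ a (q i) j := le_max_right _ _
  exact ⟨max_le (by positivity) (by linarith), by linarith⟩

/-- Passage from a bound in terms of the approximation order to a bound in terms of the number
of points. -/
lemma exists_lt_mul_exp_of_pow_four_le {d Q l₀ : ℕ} (hd : 0 < d) (hQ : 0 < Q) {c : ℝ} (hc : 1 ≤ c) :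
    ∃ C₁ : ℝ, 0 < C₁ ∧ ∃ C₂ : ℝ, 0 < C₂ ∧ ∀ n : ℕ, 0 < n → ∀ p : ℝ, 0 ≤ p → p ^ 4 ≤ c ^ 2 →
      (∀ L : ℕ, 0 < L → l₀ ≤ L → 2 * (Q * (2 * L) ^ d) ≤ n →
        p ^ 4 ≤ (2 * n * c) ^ 2 * (1 / 2) ^ L) →
      p < C₁ * Real.exp (-(C₂ * (n : ℝ) ^ ((1 : ℝ) / (d : ℝ)))) := by
  set κ : ℝ := Real.log 2 / (4 * Q) with hκ
  have hQ0 : (0 : ℝ) < Q := by exact_mod_cast hQ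
  have hκ0 : 0 < κ := div_pos (Real.log_pos one_lt_two) (by positivity)
  set A₁ : ℝ := 8 * c ^ 2 * ((2 * d).factorial / (κ / 2) ^ (2 * d)) with hA₁
  set A₂ : ℝ := c ^ 2 * Real.exp (κ / 2 * (4 * Q * (l₀ + 1))) with hA₂
  have hA₁0 : 0 ≤ A₁ := by positivity
  have hA₂0 : 0 ≤ A₂ := by positivity
  refine ⟨A₁ + A₂ + 1, by positivity, κ / 8, by positivity, fun n hn p hp hpc hpL => ?_⟩
  set s : ℝ := (n : ℝ) ^ ((1 : ℝ) / (d : ℝ)) with hs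
  have hs0 : 0 ≤ s := by positivity
  have hsd : s ^ d = n := by
    rw [hs, ← Real.rpow_natCast, ← Real.rpow_mul (by positivity)]
    have : (d : ℝ) ≠ 0 := by positivity
    simp [this]
  have key : p ^ 4 ≤ (A₁ + A₂) * Real.exp (-(κ / 2 * s)) := by
    rw [add_mul]
    by_cases hL : l₀ + 1 ≤ ⌊s / (4 * Q)⌋₊
    · refine le_trans ?_ (le_add_of_nonneg_right (by positivity))
      set L := ⌊s / (4 * Q)⌋₊ with hLdef
      have hLs : (L : ℝ) ≤ s / (4 * Q) := Nat.floor_le (by positivity)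
      have hLs' : s / (4 * Q) < L + 1 := Nat.lt_floor_add_one _
      have hLn : 2 * (Q * (2 * L) ^ d) ≤ n := by
        have h1 : (2 * (Q * (2 * L) ^ d) : ℝ) ≤ n := by
          have h2 : (2 * L : ℝ) ≤ s / (2 * Q) := by
            calc (2 * L : ℝ) ≤ 2 * (s / (4 * Q)) := by gcongr
              _ = s / (2 * Q) := by field_simp; ring
          have hQ1 : (1 : ℝ) ≤ 2 * Q := by
            have : (1 : ℝ) ≤ Q := by exact_mod_cast hQ
            linarith
          calc (2 * (Q * (2 * L) ^ d) : ℝ) ≤ 2 * (Q * (s / (2 * Q)) ^ d) := by gcongr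
            _ = 2 * Q * (n / (2 * Q) ^ d) := by rw [div_pow, hsd]; ring
            _ ≤ (2 * Q) ^ d * (n / (2 * Q) ^ d) := by
                gcongr
                exact le_self_pow₀ hQ1 hd.ne'
            _ = n := by field_simp
        exact_mod_cast h1
      have h1 := hpL L (by omega) (by omega) hLn
      have h2 : ((1 : ℝ) / 2) ^ L ≤ 2 * Real.exp (-(κ * s)) := by
        have h3 : ((1 : ℝ) / 2) ^ L = Real.exp (-(Real.log 2 * L)) := by
          rw [Real.exp_neg, mul_comm, ← Real.log_pow, Real.exp_log (by positivity), one_div, inv_pow]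
        have h4 : (2 : ℝ) * Real.exp (-(κ * s)) = Real.exp (-(Real.log 2 * (s / (4 * Q) - 1))) := by
          rw [show -(Real.log 2 * (s / (4 * Q) - 1)) = Real.log 2 + -(κ * s) by rw [hκ]; ring,
            Real.exp_add, Real.exp_log two_pos]
        rw [h3, h4]
        refine Real.exp_le_exp.2 (neg_le_neg (mul_le_mul_of_nonneg_left (by linarith) ?_))
        exact (Real.log_pos one_lt_two).le
      have h5 : s ^ (2 * d) ≤ (2 * d).factorial / (κ / 2) ^ (2 * d) * Real.exp (κ / 2 * s) := by
        have := Real.pow_div_factorial_le_exp (x := κ / 2 * s) (by positivity) (2 * d)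
        rw [div_le_iff₀ (by positivity), mul_pow] at this
        rw [div_mul_eq_mul_div, le_div_iff₀ (by positivity)]
        linarith
      have hn2 : (n : ℝ) ^ 2 = s ^ (2 * d) := by rw [← hsd]; ring
      calc p ^ 4 ≤ (2 * n * c) ^ 2 * (1 / 2) ^ L := h1
        _ ≤ (2 * n * c) ^ 2 * (2 * Real.exp (-(κ * s))) := by gcongr
        _ = 8 * c ^ 2 * s ^ (2 * d) * Real.exp (-(κ * s)) := by rw [← hn2]; ring
        _ ≤ 8 * c ^ 2 * ((2 * d).factorial / (κ / 2) ^ (2 * d) * Real.exp (κ / 2 * s))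
            * Real.exp (-(κ * s)) := by gcongr
        _ = A₁ * (Real.exp (κ / 2 * s) * Real.exp (-(κ * s))) := by rw [hA₁]; ring
        _ = A₁ * Real.exp (-(κ / 2 * s)) := by rw [← Real.exp_add]; ring_nf
    · refine le_trans ?_ (le_add_of_nonneg_left (by positivity))
      have h1 : s ≤ 4 * Q * (l₀ + 1) := by
        have := Nat.lt_of_floor_lt (not_le.1 hL)
        rw [div_lt_iff₀ (by positivity)] at this
        push_cast at this
        linarith
      refine hpc.trans ?_
      rw [hA₂, mul_assoc, ← Real.exp_add]
      refine le_mul_of_one_le_right (by positivity) (Real.one_le_exp ?_)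
      rw [← sub_eq_add_neg, ← mul_sub]
      exact mul_nonneg (by positivity) (sub_nonneg.2 h1)
  refine lt_of_pow_lt_pow_left₀ 4 (by positivity) (key.trans_lt ?_)
  rw [mul_pow, ← Real.exp_nat_mul]
  have hexp : ((4 : ℕ) : ℝ) * -(κ / 8 * s) = -(κ / 2 * s) := by push_cast; ring
  rw [hexp]
  refine mul_lt_mul_of_pos_right ?_ (Real.exp_pos _)
  calc A₁ + A₂ < A₁ + A₂ + 1 := lt_add_one _
    _ ≤ (A₁ + A₂ + 1) ^ 4 := le_self_pow₀ (by linarith) (by norm_num)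

/-- Approximation of a kernel matrix by a matrix of low rank forces fast decay of the power
function along a `P`-greedy sequence. -/
lemma IsPGreedySeq.powerFunction_pow_four_le {Ω : Type*} {K : Ω → Ω → ℝ}
    (hsym : ∀ x y, K x y = K y x) {S : Set Ω} {ξ : ℕ → Ω} (hξ : IsPGreedySeq K S ξ)
    (hpd : ∀ n : ℕ, (Matrix.of fun i j : Fin n => K (ξ i) (ξ j)).PosDef)
    {n : ℕ} (hn : 0 < n) {T : Type*} [Fintype T] (A : Matrix (Fin n) T ℝ)
    (B : Matrix T (Fin n) ℝ) {b ε : ℝ} (hε0 : 0 ≤ ε) (hε1 : ε ≤ 1)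
    (hK : ∀ i j : Fin n, |K (ξ i) (ξ j)| ≤ b)
    (hAB : ∀ i j : Fin n, |K (ξ i) (ξ j) - (A * B) i j| ≤ ε) (hT : 2 * Fintype.card T ≤ n) :
    powerFunction K (fun i : Fin n => ξ i.1) (ξ n) ^ 4 ≤ (2 * n * (b + 1)) ^ 2 * ε := by
  set p := powerFunction K (fun i : Fin n => ξ i.1) (ξ n) with hp
  have hp0 : 0 ≤ p := Real.sqrt_nonneg _
  have hb : 0 ≤ b := (abs_nonneg _).trans (hK ⟨0, hn⟩ ⟨0, hn⟩)
  set G := Matrix.of fun i j : Fin n => K (ξ i) (ξ j) with hG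
  have hdet : p ^ (2 * n) ≤ 2 ^ n * (n.factorial * ((b + 1) ^ n * ε ^ (n - Fintype.card T))) := by
    refine (hξ.powerFunction_pow_le_det hsym hpd n n le_rfl).trans ((le_abs_self _).trans ?_)
    have h := abs_det_mul_add_le A B (G - A * B) (c := b + 1) (by linarith) hε0 hε1
      (fun i j => ?_) hAB
    · rwa [add_sub_cancel] at h
    · have h1 := abs_sub_abs_le_abs_sub ((A * B) i j) (K (ξ i) (ξ j))
      rw [abs_sub_comm] at h1
      linarith [hK i j, hAB i j]
  refine le_of_pow_le_pow_left₀ hn.ne' (by positivity) ?_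
  calc (p ^ 4) ^ n = (p ^ (2 * n)) ^ 2 := by rw [← pow_mul, ← pow_mul]; ring_nf
    _ ≤ (2 ^ n * (n.factorial * ((b + 1) ^ n * ε ^ (n - Fintype.card T)))) ^ 2 := by gcongr
    _ ≤ (2 ^ n * ((n : ℝ) ^ n * ((b + 1) ^ n * ε ^ (n - Fintype.card T)))) ^ 2 := by
        gcongr
        exact_mod_cast Nat.factorial_le_pow n
    _ = ((2 * n * (b + 1)) ^ 2) ^ n * ε ^ (2 * (n - Fintype.card T)) := by
        rw [pow_mul' ε, ← pow_mul, mul_comm 2 n, pow_mul, mul_pow (2 * (n : ℝ)), mul_pow 2 (n : ℝ)]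
        ring
    _ ≤ ((2 * n * (b + 1)) ^ 2) ^ n * ε ^ n := by
        gcongr ?_ * ?_
        exact pow_le_pow_of_le_one hε0 hε1 (by omega)
    _ = ((2 * n * (b + 1)) ^ 2 * ε) ^ n := (mul_pow _ _ _).symm

/-- Convergence rate of the `P`-greedy algorithm for kernels of infinite smoothness:
there are `Ĉ₁, Ĉ₂ > 0`, depending only on `d`, `K`, `Ω`, such that for every `Ω̂ ⊆ Ω`,
every `P`-greedy sequence for `(K, Ω̂)` and every `n ≥ 1`,
`sup_{x ∈ Ω̂} P_{(ξ₁,…,ξ_n)}(x) < Ĉ₁ exp (-Ĉ₂ n^{1/d})`. -/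
theorem stmt_1 (d : ℕ) (hd : 0 < d) (Ω : Set (EuclideanSpace ℝ (Fin d)))
    (hΩne : Ω.Nonempty)
    (K : EuclideanSpace ℝ (Fin d) → EuclideanSpace ℝ (Fin d) → ℝ)
    (hsym : ∀ x y, K x y = K y x)
    (hpd : ∀ (n : ℕ) (x : Fin n → EuclideanSpace ℝ (Fin d)), (∀ i, x i ∈ Ω) →
      Function.Injective x → (Matrix.of fun i j => K (x i) (x j)).PosDef)
    (a₀ : EuclideanSpace ℝ (Fin d)) (r₀ : ℝ) (hr₀ : 0 < r₀)
    (hΩcube : Ω = {x : EuclideanSpace ℝ (Fin d) | ∀ i, |x i - a₀ i| ≤ r₀})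
    (φ : ℝ → ℝ) (hKφ : ∀ x ∈ Ω, ∀ y ∈ Ω, K x y = φ ‖x - y‖)
    (l₀ : ℕ) (hl₀ : 0 < l₀) (M : ℝ) (hM : 0 < M)
    (hϕsmooth : ContDiffOn ℝ (⊤ : ℕ∞) (fun r : ℝ => φ (Real.sqrt r)) (Set.Ici 0))
    (hϕbd : ∀ l : ℕ, l₀ ≤ l → ∀ r : ℝ, 0 ≤ r →
      |iteratedDerivWithin l (fun r : ℝ => φ (Real.sqrt r)) (Set.Ici 0) r| ≤
        (l.factorial : ℝ) * M ^ l) :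
    ∃ C₁ : ℝ, 0 < C₁ ∧ ∃ C₂ : ℝ, 0 < C₂ ∧
      ∀ Ωh : Set (EuclideanSpace ℝ (Fin d)), Ωh ⊆ Ω →
        ∀ ξ : ℕ → EuclideanSpace ℝ (Fin d), IsPGreedySeq K Ωh ξ →
          ∀ n : ℕ, 0 < n →
            sSup ((fun x => powerFunction K (fun i : Fin n => ξ i.1) x) '' Ωh) <
              C₁ * Real.exp (-(C₂ * (n : ℝ) ^ ((1 : ℝ) / (d : ℝ)))) := by
  have hΩb : Bornology.IsBounded Ω := by
    rw [Metric.isBounded_iff_subset_closedBall a₀]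
    refine ⟨Real.sqrt (∑ _i : Fin d, r₀ ^ 2), fun x hx => ?_⟩
    rw [hΩcube] at hx
    rw [Metric.mem_closedBall, EuclideanSpace.dist_eq]
    refine Real.sqrt_le_sqrt (Finset.sum_le_sum fun i _ => ?_)
    rw [Real.dist_eq]
    gcongr
    exact hx i
  set f : ℝ → ℝ := fun r => φ (Real.sqrt r) with hf
  have hKf : ∀ x ∈ Ω, ∀ y ∈ Ω, K x y = f (‖x - y‖ ^ 2) := fun x hx y hy => by
    rw [hKφ x hx y hy, hf]
    simp only [Real.sqrt_sq (norm_nonneg _)]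
  obtain ⟨b, hb⟩ : ∃ b : ℝ, ∀ x ∈ Ω, ∀ y ∈ Ω, |K x y| ≤ b := by
    obtain ⟨D, hD⟩ := Metric.isBounded_iff.1 hΩb
    obtain ⟨b, hb⟩ := (isCompact_Icc (a := (0 : ℝ)) (b := D ^ 2)).exists_bound_of_continuousOn
      (hϕsmooth.continuousOn.mono fun r hr => hr.1)
    refine ⟨b, fun x hx y hy => ?_⟩
    rw [hKf x hx y hy]
    refine hb _ ⟨by positivity, ?_⟩
    have := hD hx hy
    rw [dist_eq_norm] at this
    gcongr
  have hb0 : 0 ≤ b := by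
    obtain ⟨z, hz⟩ := hΩne
    exact (abs_nonneg _).trans (hb z hz z hz)
  obtain ⟨Q, hQ, happrox⟩ := exists_low_rank_approx hΩne hΩb hM hϕsmooth hϕbd
  obtain ⟨C₁, hC₁, C₂, hC₂, hC⟩ := exists_lt_mul_exp_of_pow_four_le (l₀ := l₀) hd hQ
    (c := b + 1) (by linarith)
  refine ⟨C₁, hC₁, C₂, hC₂, fun Ωh hΩh ξ hξ n hn => ?_⟩
  have hξΩ : ∀ i, ξ i ∈ Ω := fun i => hΩh (hξ.1 i)
  have hpdξ : ∀ m : ℕ, (Matrix.of fun i j : Fin m => K (ξ i) (ξ j)).PosDef := fun m =>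
    hpd m (fun i => ξ i) (fun i => hξΩ i) (hξ.2.1.comp Fin.val_injective)
  have hsup : sSup ((fun x => powerFunction K (fun i : Fin n => ξ i.1) x) '' Ωh)
      ≤ powerFunction K (fun i : Fin n => ξ i.1) (ξ n) := by
    refine csSup_le (Set.Nonempty.image _ ⟨ξ 0, hξ.1 0⟩) ?_
    rintro _ ⟨x, hx, rfl⟩
    exact hξ.2.2.2 n hn x hx
  refine hsup.trans_lt (hC n hn _ (Real.sqrt_nonneg _) ?_ fun L hL hl hLn => ?_)
  · have h0 := powerFunction_le_of_le K ξ hpdξ (Nat.zero_le n) (ξ n)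
    rw [powerFunction_zero] at h0
    have hKb : K (ξ n) (ξ n) ≤ b + 1 := by
      linarith [(le_abs_self _).trans (hb _ (hξΩ n) _ (hξΩ n))]
    calc powerFunction K (fun i : Fin n => ξ i.1) (ξ n) ^ 4 ≤ Real.sqrt (b + 1) ^ 4 := by
          gcongr
          · exact Real.sqrt_nonneg _
          · exact h0.trans (Real.sqrt_le_sqrt hKb)
      _ = (Real.sqrt (b + 1) ^ 2) ^ 2 := by ring
      _ = (b + 1) ^ 2 := by rw [Real.sq_sqrt (by linarith)]
  · obtain ⟨A, B, hAB⟩ := happrox L hL hl n (fun i => ξ i) fun i => hξΩ i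
    refine hξ.powerFunction_pow_four_le hsym hpdξ hn A B (by positivity)
      (pow_le_one₀ (by norm_num) (by norm_num)) (fun i j => hb _ (hξΩ i) _ (hξΩ j))
      (fun i j => ?_) (by simpa using hLn)
    rw [hKf _ (hξΩ i) _ (hξΩ j)]
    exact hAB i j
end

section
/- Suppose (K, Ω) has infinite smoothness. Then there exist constants C₁, C₂ > 0, depending only on d, K, and Ω, with the following property: for every subset Ω̂ ⊆ Ω, every P-greedy sequence ξ₁, ξ₂, … for (K, Ω̂), all α, q > 0, and every T ∈ ℤ_{>0}, if D ≥ 2 is the smallest positive integer n such that sup_{x ∈ Ω̂} P_{(ξ₁,…,ξ_n)}(x) < α/T^q (i.e., the P-greedy algorithm with admissible error α/T^q returns D points), then D ≤ 1 + (C₂ · (C₁ + q·log T − log α))^d. -/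
open Matrix

/-- A determinant bound for a positive semidefinite matrix whose quadratic form is small on the
kernel of a linear map of small rank. -/
lemma det_le_of_quadForm_le_on_ker {n : ℕ} {A : Matrix (Fin n) (Fin n) ℝ} (hA : A.PosSemidef)
    {ι : Type*} [Fintype ι] (V : Matrix ι (Fin n) ℝ) {b ε : ℝ} (hb : 1 ≤ b) (hε0 : 0 < ε)
    (hε1 : ε ≤ 1) (hdiag : ∀ i, A i i ≤ b)
    (hQ : ∀ c, V *ᵥ c = 0 → c ⬝ᵥ (A *ᵥ c) ≤ n * ε * (c ⬝ᵥ c)) :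
    A.det ≤ (n * b) ^ n * ε ^ (n - Fintype.card ι) := by
  classical
  set ev := hA.1.eigenvalues with hev
  set U : Matrix (Fin n) (Fin n) ℝ :=
    (hA.1.eigenvectorUnitary : Matrix (Fin n) (Fin n) ℝ) with hU
  have hUU : Uᵀ * U = 1 := by
    have := Unitary.coe_star_mul_self hA.1.eigenvectorUnitary
    simpa [star_eq_conjTranspose] using this
  have hAU : A * U = U * diagonal ev := by
    have h := hA.1.spectral_theorem
    rw [Unitary.conjStarAlgAut_apply] at h
    have h2 : A = U * diagonal ev * Uᵀ := by
      simpa [star_eq_conjTranspose] using h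
    conv_lhs => rw [h2, Matrix.mul_assoc, hUU, Matrix.mul_one]
  have hev0 : ∀ i, 0 ≤ ev i := hA.eigenvalues_nonneg
  have hevb : ∀ i, ev i ≤ n * b := by
    intro i
    calc ev i ≤ ∑ j, ev j := Finset.single_le_sum (fun j _ => hev0 j) (Finset.mem_univ i)
      _ = A.trace := by simpa using hA.1.trace_eq_sum_eigenvalues.symm
      _ ≤ ∑ _j : Fin n, b := Finset.sum_le_sum fun j _ => hdiag j
      _ = n * b := by simp
  set S : Finset (Fin n) := Finset.univ.filter fun i => n * ε < ev i with hS
  have hcard : S.card ≤ Fintype.card ι := by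
    by_contra! hlt
    let ext : (S → ℝ) →ₗ[ℝ] (Fin n → ℝ) :=
      Function.ExtendByZero.linearMap ℝ (Subtype.val : S → Fin n)
    have hker : LinearMap.ker (V.mulVecLin ∘ₗ U.mulVecLin ∘ₗ ext) ≠ ⊥ :=
      LinearMap.ker_ne_bot_of_finrank_lt (by simpa using hlt)
    obtain ⟨a, ha, ha0⟩ := (Submodule.ne_bot_iff _).1 hker
    have hval : ∀ i (hi : i ∈ S), ext a i = a ⟨i, hi⟩ := fun i hi =>
      Subtype.val_injective.extend_apply a 0 ⟨i, hi⟩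
    have hout : ∀ i, i ∉ S → ext a i = 0 := fun i hi => by
      refine Function.extend_apply' _ _ _ ?_
      rintro ⟨j, rfl⟩
      exact hi j.2
    have h1 := hQ (U *ᵥ ext a) (by simpa using ha)
    have hdot : ∀ v w : Fin n → ℝ, (U *ᵥ v) ⬝ᵥ (U *ᵥ w) = v ⬝ᵥ w := by
      intro v w
      rw [Matrix.dotProduct_mulVec, Matrix.vecMul_mulVec, ← Matrix.dotProduct_mulVec, hUU,
        Matrix.one_mulVec]
    rw [Matrix.mulVec_mulVec, hAU, ← Matrix.mulVec_mulVec, hdot, hdot] at h1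
    refine absurd h1 (not_le.2 ?_)
    simp only [dotProduct, Matrix.mulVec_diagonal, Finset.mul_sum]
    obtain ⟨i, hi⟩ : ∃ i, a i ≠ 0 := by
      by_contra! h
      exact ha0 (funext h)
    refine Finset.sum_lt_sum (fun j _ => ?_) ⟨i, Finset.mem_univ _, ?_⟩
    · by_cases hj : j ∈ S
      · have := (Finset.mem_filter.1 hj).2
        nlinarith [mul_self_nonneg (ext a j)]
      · simp [hout j hj]
    · have := (Finset.mem_filter.1 i.2).2
      have h3 : 0 < ext a i * ext a i := by
        rw [hval i.1 i.2]
        exact mul_self_pos.2 hi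
      nlinarith
  have hdet : A.det = ∏ i, ev i := by simpa using hA.1.det_eq_prod_eigenvalues
  have hn0 : (0 : ℝ) ≤ n := Nat.cast_nonneg n
  calc A.det = ∏ i, ev i := hdet
    _ ≤ ∏ i, (n * b) * (if i ∈ S then 1 else ε) := by
        refine Finset.prod_le_prod (fun i _ => hev0 i) fun i _ => ?_
        split_ifs with hi
        · simpa using hevb i
        · have h1 : ev i ≤ n * ε := by simpa [hS] using hi
          have h2 : 0 ≤ n * ε := by positivity
          nlinarith
    _ = (n * b) ^ n * ε ^ (n - S.card) := by
        rw [Finset.prod_mul_distrib, Finset.prod_ite]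
        simp [Finset.filter_not, Finset.card_sdiff, Finset.card_univ]
    _ ≤ _ := by
        refine mul_le_mul_of_nonneg_left ?_ (by positivity)
        exact pow_le_pow_of_le_one hε0.le hε1 (by omega)

/-- The determinant of a kernel matrix is the product of the squared power function values. -/
lemma det_kernelMatrix_eq_prod_powerFunction {Ω : Type*} (K : Ω → Ω → ℝ)
    (hsym : ∀ x y, K x y = K y x) (ξ : ℕ → Ω)
    (hpd : ∀ n : ℕ, (Matrix.of fun i j : Fin n => K (ξ i) (ξ j)).PosDef) (n : ℕ) :
    (Matrix.of fun i j : Fin n => K (ξ i) (ξ j)).det =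
      ∏ m ∈ Finset.range n, powerFunction K (fun i : Fin m => ξ i) (ξ m) ^ 2 := by
  induction n with
  | zero => simp
  | succ n ih =>
    rw [Finset.prod_range_succ, ← ih]
    set A := Matrix.of fun i j : Fin n => K (ξ i) (ξ j) with hA
    set k : Fin n → ℝ := fun i => K (ξ n) (ξ i) with hk
    have hAdet : 0 < A.det := (hpd n).det_pos
    have := A.invertibleOfIsUnitDet hAdet.ne'.isUnit
    have hblock : (Matrix.of fun i j : Fin (n + 1) => K (ξ i) (ξ j)).det =
        A.det * (K (ξ n) (ξ n) - k ⬝ᵥ (A⁻¹ *ᵥ k)) := by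
      rw [← Matrix.det_submatrix_equiv_self (finSumFinEquiv : Fin n ⊕ Fin 1 ≃ Fin (n + 1))]
      have : (Matrix.of fun i j : Fin (n + 1) => K (ξ i) (ξ j)).submatrix finSumFinEquiv
          finSumFinEquiv = Matrix.fromBlocks A (Matrix.of fun i (_ : Fin 1) => k i)
            (Matrix.of fun (_ : Fin 1) i => k i) (Matrix.of fun _ _ => K (ξ n) (ξ n)) := by
        ext i j
        rcases i with i | i <;> rcases j with j | j <;>
          simp [hA, hk, hsym (ξ n)]
      rw [this, Matrix.det_fromBlocks₁₁, Matrix.invOf_eq_nonsing_inv, Matrix.mul_assoc,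
        Matrix.det_fin_one]
      rfl
    rw [hblock]
    have hpos : 0 < K (ξ n) (ξ n) - k ⬝ᵥ (A⁻¹ *ᵥ k) := by
      have h := (hpd (n + 1)).det_pos
      rw [hblock] at h
      exact pos_of_mul_pos_right h hAdet.le
    rw [powerFunction, Real.sq_sqrt hpos.le]

/-- The power function is at most `sqrt (K(x,x))`. -/
lemma powerFunction_le_sqrt {Ω : Type*} (K : Ω → Ω → ℝ) {n : ℕ} (X : Fin n → Ω) (x : Ω)
    (hX : (Matrix.of fun i j => K (X i) (X j)).PosDef) :
    powerFunction K X x ≤ Real.sqrt (K x x) := by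
  refine Real.sqrt_le_sqrt ?_
  have := hX.inv.posSemidef.dotProduct_mulVec_nonneg fun i => K x (X i)
  simp only [star_trivial] at this
  linarith

/-- One-sided Taylor approximation with geometric error for functions on `[0, ∞)` whose
derivatives of high order satisfy `|f⁽ˡ⁾| ≤ l! Mˡ`. -/
lemma exists_taylor_approx {f : ℝ → ℝ} {M : ℝ} (hM : 0 < M) {l₀ l : ℕ}
    (hf : ContDiffOn ℝ (⊤ : ℕ∞) f (Set.Ici 0))
    (hbd : ∀ l : ℕ, l₀ ≤ l → ∀ r : ℝ, 0 ≤ r →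
      |iteratedDerivWithin l f (Set.Ici 0) r| ≤ (l.factorial : ℝ) * M ^ l)
    (hl : l₀ ≤ l) (hl1 : 0 < l) {s : ℝ} (hs : 0 ≤ s) :
    ∃ a : ℕ → ℝ, ∀ r ∈ Set.Icc s (s + 1 / (4 * M)),
      |f r - ∑ k ∈ Finset.range l, a k * (r - s) ^ k| ≤ (1 / 2) ^ l := by
  obtain ⟨m, rfl⟩ : ∃ m, l = m + 1 := ⟨l - 1, by omega⟩
  have hw : 0 < 1 / (4 * M) := by positivity
  have hsub : Set.Icc s (s + 1 / (4 * M)) ⊆ Set.Ici 0 := fun r hr => hs.trans hr.1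
  have hsw : s < s + 1 / (4 * M) := by linarith
  refine ⟨fun k => (k.factorial : ℝ)⁻¹ * iteratedDerivWithin k f (Set.Icc s (s + 1 / (4 * M))) s,
    fun r hr => ?_⟩
  have hfm : ContDiffOn ℝ ((m + 1 : ℕ) : WithTop ℕ∞) f (Set.Ici 0) :=
    hf.of_le (by exact_mod_cast le_top)
  have h := taylor_mean_remainder_bound (n := m) (C := (m + 1).factorial * M ^ (m + 1)) hsw.le
    (by exact_mod_cast hfm.mono hsub) hr (fun y hy => by
      have heq : iteratedDerivWithin (m + 1) f (Set.Icc s (s + 1 / (4 * M))) y =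
          iteratedDerivWithin (m + 1) f (Set.Ici 0) y := by
        simp only [iteratedDerivWithin]
        rw [iteratedFDerivWithin_subset hsub (uniqueDiffOn_Icc hsw) (uniqueDiffOn_Ici 0) hfm hy]
      rw [heq]
      exact hbd _ hl y (hsub hy))
  rw [taylor_within_apply, Real.norm_eq_abs] at h
  have hsum : ∑ k ∈ Finset.range (m + 1), ((k.factorial : ℝ)⁻¹ * (r - s) ^ k) •
        iteratedDerivWithin k f (Set.Icc s (s + 1 / (4 * M))) s =
      ∑ k ∈ Finset.range (m + 1), ((k.factorial : ℝ)⁻¹ *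
        iteratedDerivWithin k f (Set.Icc s (s + 1 / (4 * M))) s) * (r - s) ^ k :=
    Finset.sum_congr rfl fun k _ => by rw [smul_eq_mul]; ring
  rw [hsum] at h
  refine h.trans ?_
  have hrs : 0 ≤ r - s := sub_nonneg.2 hr.1
  have hMr : M * (r - s) ≤ 1 / 4 := by
    have h1 : r - s ≤ 1 / (4 * M) := by linarith [hr.2]
    calc M * (r - s) ≤ M * (1 / (4 * M)) := by gcongr
      _ = 1 / 4 := by field_simp
  have hm2 : ((m + 1 : ℕ) : ℝ) ≤ 2 ^ (m + 1) := by exact_mod_cast (Nat.lt_two_pow_self).le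
  have hfac : (m.factorial : ℝ) ≠ 0 := by positivity
  calc ((m + 1).factorial : ℝ) * M ^ (m + 1) * (r - s) ^ (m + 1) / m.factorial
      = ((m + 1 : ℕ) : ℝ) * (M * (r - s)) ^ (m + 1) := by
        rw [Nat.factorial_succ, mul_pow]; push_cast; field_simp
    _ ≤ 2 ^ (m + 1) * (1 / 4) ^ (m + 1) := by gcongr
    _ = (1 / 2) ^ (m + 1) := by rw [← mul_pow]; norm_num

/-- Local polynomial approximation of a radial kernel `φ(‖x - y‖)` in the variable `x` near `c`. -/
lemma exists_mvPolynomial_approx {d : ℕ} {φ : ℝ → ℝ} {M : ℝ} (hM : 0 < M) {l₀ l : ℕ}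
    (hf : ContDiffOn ℝ (⊤ : ℕ∞) (fun r : ℝ => φ (Real.sqrt r)) (Set.Ici 0))
    (hbd : ∀ l : ℕ, l₀ ≤ l → ∀ r : ℝ, 0 ≤ r →
      |iteratedDerivWithin l (fun r : ℝ => φ (Real.sqrt r)) (Set.Ici 0) r| ≤
        (l.factorial : ℝ) * M ^ l)
    (hl : l₀ ≤ l) (hl1 : 0 < l) (c y : EuclideanSpace ℝ (Fin d)) :
    ∃ p : MvPolynomial (Fin d) ℝ, p.totalDegree < 2 * l ∧
      ∀ x : EuclideanSpace ℝ (Fin d), |‖x - y‖ ^ 2 - ‖c - y‖ ^ 2| ≤ 1 / (8 * M) →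
        |φ ‖x - y‖ - MvPolynomial.eval (fun i => x i) p| ≤ (1 / 2) ^ l := by
  set s : ℝ := max 0 (‖c - y‖ ^ 2 - 1 / (8 * M)) with hs
  obtain ⟨a, ha⟩ := exists_taylor_approx hM hf hbd hl hl1 (le_max_left _ _ : 0 ≤ s)
  refine ⟨∑ k ∈ Finset.range l, MvPolynomial.C (a k) *
    (∑ i, (MvPolynomial.X i - MvPolynomial.C (y i)) ^ 2 - MvPolynomial.C s) ^ k, ?_, ?_⟩
  · refine lt_of_le_of_lt (MvPolynomial.totalDegree_finsetSum_le (d := 2 * (l - 1))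
      fun k hk => ?_) (by omega)
    have hq : (∑ i, (MvPolynomial.X i - MvPolynomial.C (y i)) ^ 2 - MvPolynomial.C s :
        MvPolynomial (Fin d) ℝ).totalDegree ≤ 2 := by
      refine (MvPolynomial.totalDegree_sub_C_le _ _).trans ?_
      refine MvPolynomial.totalDegree_finsetSum_le fun i _ => ?_
      refine (MvPolynomial.totalDegree_pow _ _).trans ?_
      have := MvPolynomial.totalDegree_sub_C_le (MvPolynomial.X i : MvPolynomial (Fin d) ℝ) (y i)
      rw [MvPolynomial.totalDegree_X] at this
      omega
    refine (MvPolynomial.totalDegree_mul _ _).trans ?_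
    rw [MvPolynomial.totalDegree_C, zero_add]
    refine (MvPolynomial.totalDegree_pow _ _).trans ?_
    have : k ≤ l - 1 := by have := Finset.mem_range.1 hk; omega
    calc k * _ ≤ (l - 1) * 2 := Nat.mul_le_mul this hq
      _ = 2 * (l - 1) := by ring
  · intro x hx
    have h := ha (‖x - y‖ ^ 2) ⟨?_, ?_⟩
    · rw [Real.sqrt_sq (norm_nonneg _)] at h
      simpa [EuclideanSpace.real_norm_sq_eq, hs] using h
    · exact max_le (by positivity) (by linarith [(abs_le.1 hx).1])
    · have h1 := le_max_right 0 (‖c - y‖ ^ 2 - 1 / (8 * M))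
      have h2 : 1 / (4 * M) = 2 * (1 / (8 * M)) := by field_simp; norm_num
      rw [h2]
      linarith [(abs_le.1 hx).2]

/-- A bounded set in Euclidean space splits into finitely many cells on which squared distances
to points of the set are nearly constant. -/
lemma exists_finite_cells {d : ℕ} {Ω : Set (EuclideanSpace ℝ (Fin d))}
    (hΩ : Bornology.IsBounded Ω) {δ : ℝ} (hδ : 0 < δ) :
    ∃ t : Finset (EuclideanSpace ℝ (Fin d)), ∀ x ∈ Ω, ∃ c ∈ t, ∀ y ∈ Ω,
      |‖x - y‖ ^ 2 - ‖c - y‖ ^ 2| ≤ δ := by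
  obtain ⟨R, hR0, hR⟩ : ∃ R : ℝ, 0 < R ∧ ∀ x ∈ Ω, ∀ y ∈ Ω, ‖x - y‖ ≤ R := by
    obtain ⟨R, hR⟩ := Metric.isBounded_iff.1 hΩ
    exact ⟨max R 1, by positivity, fun x hx y hy =>
      (dist_eq_norm x y ▸ hR hx hy).trans (le_max_left _ _)⟩
  obtain ⟨t, htΩ, htf, ht⟩ := Metric.finite_approx_of_totallyBounded
    (hΩ.isCompact_closure.totallyBounded.subset subset_closure) (δ / (2 * R)) (by positivity)
  refine ⟨htf.toFinset, fun x hx => ?_⟩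
  obtain ⟨c, hc, hxc⟩ := Set.mem_iUnion₂.1 (ht hx)
  refine ⟨c, by simpa using hc, fun y hy => ?_⟩
  have h1 : |‖x - y‖ - ‖c - y‖| ≤ δ / (2 * R) := by
    refine (abs_norm_sub_norm_le _ _).trans ?_
    rw [sub_sub_sub_cancel_right, ← dist_eq_norm]
    exact (Metric.mem_ball.1 hxc).le
  have h2 : |‖x - y‖ + ‖c - y‖| ≤ 2 * R := by
    rw [abs_of_nonneg (by positivity)]
    linarith [hR x hx y hy, hR c (htΩ hc) y hy]
  calc |‖x - y‖ ^ 2 - ‖c - y‖ ^ 2| = |‖x - y‖ - ‖c - y‖| * |‖x - y‖ + ‖c - y‖| := by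
        rw [← abs_mul]; ring_nf
    _ ≤ δ / (2 * R) * (2 * R) := by gcongr
    _ = δ := by field_simp

/-- Weights annihilating all monomials of small multidegree annihilate all polynomials of small
total degree. -/
lemma sum_mul_eval_eq_zero {ι : Type*} {d m : ℕ} (s : Finset ι) (w : ι → ℝ)
    (x : ι → Fin d → ℝ)
    (h : ∀ β : Fin d → Fin m, ∑ i ∈ s, w i * ∏ k, x i k ^ (β k : ℕ) = 0)
    {p : MvPolynomial (Fin d) ℝ} (hp : p.totalDegree < m) :
    ∑ i ∈ s, w i * MvPolynomial.eval (x i) p = 0 := by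
  simp only [MvPolynomial.eval_eq', Finset.mul_sum]
  rw [Finset.sum_comm]
  refine Finset.sum_eq_zero fun β hβ => ?_
  have hlt : ∀ k, β k < m := fun k =>
    ((Finsupp.le_degree k β).trans (MvPolynomial.le_totalDegree hβ)).trans_lt hp
  have := h fun k => ⟨β k, hlt k⟩
  calc _ = MvPolynomial.coeff β p * ∑ i ∈ s, w i * ∏ k, x i k ^ β k := by
        rw [Finset.mul_sum]
        exact Finset.sum_congr rfl fun i _ => by ring
    _ = 0 := by rw [this, mul_zero]

/-- A quadratic form is small on weights annihilating all cellwise monomials if the matrix is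
cellwise approximated by polynomials. -/
lemma quadForm_le_of_cellwise_approx {n d m : ℕ} {A : Matrix (Fin n) (Fin n) ℝ} {κ : Type*}
    [Fintype κ] [DecidableEq κ] (cell : Fin n → κ) (x : Fin n → Fin d → ℝ)
    (p : κ → Fin n → MvPolynomial (Fin d) ℝ) (hp : ∀ a j, (p a j).totalDegree < m) {ε : ℝ}
    (hA : ∀ i j, |A i j - MvPolynomial.eval (x i) (p (cell i) j)| ≤ ε) (c : Fin n → ℝ)
    (hc : ∀ (a : κ) (β : Fin d → Fin m),
      ∑ i with cell i = a, c i * ∏ k, x i k ^ (β k : ℕ) = 0) :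
    c ⬝ᵥ (A *ᵥ c) ≤ n * ε * (c ⬝ᵥ c) := by
  have hzero : ∀ j, ∑ i, c i * MvPolynomial.eval (x i) (p (cell i) j) = 0 := by
    intro j
    rw [← Finset.sum_fiberwise Finset.univ cell]
    refine Finset.sum_eq_zero fun a _ => ?_
    rw [← sum_mul_eval_eq_zero _ c x (hc a) (hp a j)]
    refine Finset.sum_congr rfl fun i hi => ?_
    rw [(Finset.mem_filter.1 hi).2]
  rcases n.eq_zero_or_pos with rfl | hn
  · simp
  have hε : 0 ≤ ε := (abs_nonneg _).trans (hA ⟨0, hn⟩ ⟨0, hn⟩)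
  calc c ⬝ᵥ (A *ᵥ c) = ∑ j, ∑ i, c i * A i j * c j := by
        simp only [dotProduct, mulVec, Finset.mul_sum]
        rw [Finset.sum_comm]
        exact Finset.sum_congr rfl fun j _ => Finset.sum_congr rfl fun i _ => by ring
    _ = ∑ j, ∑ i, c i * (A i j - MvPolynomial.eval (x i) (p (cell i) j)) * c j := by
        refine Finset.sum_congr rfl fun j _ => ?_
        simp only [← Finset.sum_mul, mul_sub, Finset.sum_sub_distrib, hzero, sub_zero]
    _ ≤ ∑ j, ∑ i, |c i| * ε * |c j| := by
        refine Finset.sum_le_sum fun j _ => Finset.sum_le_sum fun i _ => ?_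
        refine (le_abs_self _).trans ?_
        rw [abs_mul, abs_mul]
        gcongr
        exact hA i j
    _ = ε * (∑ i, |c i|) ^ 2 := by
        rw [sq, Finset.sum_mul_sum, Finset.mul_sum, Finset.sum_comm]
        refine Finset.sum_congr rfl fun j _ => ?_
        rw [Finset.mul_sum]
        exact Finset.sum_congr rfl fun i _ => by ring
    _ ≤ ε * (n * ∑ i, |c i| ^ 2) := by
        gcongr
        simpa using sq_sum_le_card_mul_sum_sq (s := Finset.univ) (f := fun i => |c i|)
    _ = n * ε * (c ⬝ᵥ c) := by
        simp only [dotProduct, sq_abs, ← sq]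
        ring

/-- Exponential decay of the power function along a sequence of points along which it is bounded
below by `τ`, for a radial kernel of infinite smoothness. -/
lemma exists_pow_four_le_of_le_powerFunction {d : ℕ} {Ω : Set (EuclideanSpace ℝ (Fin d))}
    (hΩ : Bornology.IsBounded Ω)
    (K : EuclideanSpace ℝ (Fin d) → EuclideanSpace ℝ (Fin d) → ℝ)
    (hsym : ∀ x y, K x y = K y x)
    (hpd : ∀ (n : ℕ) (x : Fin n → EuclideanSpace ℝ (Fin d)), (∀ i, x i ∈ Ω) →
      Function.Injective x → (Matrix.of fun i j => K (x i) (x j)).PosDef)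
    {φ : ℝ → ℝ} (hKφ : ∀ x ∈ Ω, ∀ y ∈ Ω, K x y = φ ‖x - y‖)
    {M : ℝ} (hM : 0 < M) {l₀ : ℕ}
    (hf : ContDiffOn ℝ (⊤ : ℕ∞) (fun r : ℝ => φ (Real.sqrt r)) (Set.Ici 0))
    (hbd : ∀ l : ℕ, l₀ ≤ l → ∀ r : ℝ, 0 ≤ r →
      |iteratedDerivWithin l (fun r : ℝ => φ (Real.sqrt r)) (Set.Ici 0) r| ≤
        (l.factorial : ℝ) * M ^ l) {b : ℝ} (hb : 1 ≤ b) (hKb : ∀ x ∈ Ω, K x x ≤ b) :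
    ∃ N : ℕ, 0 < N ∧ ∀ ξ : ℕ → EuclideanSpace ℝ (Fin d), (∀ n, ξ n ∈ Ω) →
      Function.Injective ξ → ∀ l n : ℕ, l₀ ≤ l → 0 < l → 0 < n → 2 * (N * (2 * l) ^ d) ≤ n →
      ∀ τ : ℝ, 0 < τ → (∀ m < n, τ ≤ powerFunction K (fun i : Fin m => ξ i.1) (ξ m)) →
        τ ^ 4 ≤ (n * b) ^ 2 * (1 / 2) ^ l := by
  classical
  obtain ⟨t, ht⟩ := exists_finite_cells hΩ (show (0 : ℝ) < 1 / (8 * M) by positivity)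
  refine ⟨t.card + 1, Nat.succ_pos _, fun ξ hξ hinj l n hl hl1 hn hln τ hτ hP => ?_⟩
  have hpdξ : ∀ n : ℕ, (Matrix.of fun i j : Fin n => K (ξ i) (ξ j)).PosDef := fun n =>
    hpd n (fun i => ξ i) (fun i => hξ i) (hinj.comp Fin.val_injective)
  choose! cell hcell hcell' using ht
  choose p hpdeg hp using fun c y => exists_mvPolynomial_approx hM hf hbd hl hl1 c y
  have hdet := det_kernelMatrix_eq_prod_powerFunction K hsym ξ hpdξ n
  have hlow : τ ^ (2 * n) ≤ (Matrix.of fun i j : Fin n => K (ξ i) (ξ j)).det := by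
    have hconst : τ ^ (2 * n) = ∏ _m ∈ Finset.range n, τ ^ 2 := by simp [pow_mul]
    rw [hdet, hconst]
    refine Finset.prod_le_prod (fun _ _ => by positivity) fun m hm => ?_
    exact pow_le_pow_left₀ hτ.le (hP m (by simpa using hm)) 2
  let V : Matrix (t × (Fin d → Fin (2 * l))) (Fin n) ℝ := Matrix.of fun aβ i =>
    if cell (ξ i) = aβ.1 then ∏ k, ξ i k ^ (aβ.2 k : ℕ) else 0
  have hup := det_le_of_quadForm_le_on_ker (hpdξ n).posSemidef V (ε := (1 / 2) ^ l) hb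
    (by positivity) (pow_le_one₀ (by norm_num) (by norm_num)) (fun i => hKb _ (hξ i)) (by
      intro c hc
      refine quadForm_le_of_cellwise_approx (m := 2 * l)
        (fun i => (⟨cell (ξ i), hcell _ (hξ i)⟩ : t)) (fun i k => ξ i k)
        (fun a j => p a (ξ j)) (fun a j => hpdeg _ _) (fun i j => ?_) c fun a β => ?_
      · rw [Matrix.of_apply, hKφ _ (hξ i) _ (hξ j)]
        exact hp _ _ _ (hcell' _ (hξ i) _ (hξ j))
      · have : (V *ᵥ c) (a, β) = 0 := congrFun hc (a, β)
        rw [← this, Finset.sum_filter]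
        refine Finset.sum_congr rfl fun i _ => ?_
        simp only [V, Matrix.of_apply, Subtype.ext_iff]
        split_ifs <;> ring)
  have hcard : Fintype.card (t × (Fin d → Fin (2 * l))) = t.card * (2 * l) ^ d := by simp
  rw [hcard] at hup
  have hexp : n ≤ 2 * (n - t.card * (2 * l) ^ d) := by
    have : t.card * (2 * l) ^ d ≤ (t.card + 1) * (2 * l) ^ d :=
      Nat.mul_le_mul_right _ (Nat.le_succ _)
    omega
  have hpow : (τ ^ 4) ^ n ≤ ((n * b) ^ 2 * (1 / 2) ^ l) ^ n := by
    calc (τ ^ 4) ^ n = (τ ^ (2 * n)) ^ 2 := by ring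
      _ ≤ ((n * b) ^ n * ((1 / 2) ^ l) ^ (n - t.card * (2 * l) ^ d)) ^ 2 := by
          gcongr
          exact hlow.trans hup
      _ = ((n * b) ^ 2) ^ n * ((1 / 2) ^ l) ^ (2 * (n - t.card * (2 * l) ^ d)) := by ring
      _ ≤ ((n * b) ^ 2) ^ n * ((1 / 2) ^ l) ^ n := by
          refine mul_le_mul_of_nonneg_left ?_ (by positivity)
          exact pow_le_pow_of_le_one (by positivity)
            (pow_le_one₀ (by norm_num) (by norm_num)) hexp
      _ = _ := (mul_pow _ _ _).symm
  exact le_of_pow_le_pow_left₀ hn.ne' (by positivity) hpow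

/-- Solving the exponential decay estimate for the number of points. -/
lemma exists_card_le_of_pow_four_le {d N l₀ : ℕ} (hd : 0 < d) (hN : 0 < N) {b : ℝ}
    (hb : 1 ≤ b) :
    ∃ C₁ : ℝ, 0 < C₁ ∧ ∃ C₂ : ℝ, 0 < C₂ ∧ ∀ (n : ℕ) (τ : ℝ), 0 < n → 0 < τ → τ ≤ b →
      (∀ l : ℕ, l₀ ≤ l → 0 < l → 2 * (N * (2 * l) ^ d) ≤ n →
        τ ^ 4 ≤ (n * b) ^ 2 * (1 / 2) ^ l) →
      (n : ℝ) ≤ (C₂ * (C₁ - Real.log τ)) ^ d := by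
  have hN1 : (1 : ℝ) ≤ N := by exact_mod_cast hN
  have hd1 : (1 : ℝ) ≤ d := by exact_mod_cast hd
  set a : ℝ := 64 * N * d with ha
  have ha1 : 1 ≤ a := by nlinarith [mul_le_mul hN1 hd1 zero_le_one (by linarith)]
  have hloga : 0 ≤ Real.log a := Real.log_nonneg ha1
  have hlogb : 0 ≤ Real.log b := Real.log_nonneg hb
  set C : ℝ := (2 * Real.log b + 2 * d * Real.log a) / 4 with hC
  have hC0 : 0 ≤ C := by positivity
  refine ⟨C + Real.log b + (l₀ + 1) + 1, by positivity, 128 * N, by positivity,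
    fun n τ hn hτ hτb h => ?_⟩
  have hlogτ : Real.log τ ≤ Real.log b := Real.log_le_log hτ hτb
  have hcrude : ∀ l : ℕ, n ≤ 2 * (N * (2 * l) ^ d) → (n : ℝ) ≤ (4 * N * l) ^ d := by
    intro l hl
    have h1 : (n : ℝ) ≤ 2 * N * (2 * l) ^ d := by
      have : (n : ℝ) ≤ ((2 * (N * (2 * l) ^ d) : ℕ) : ℝ) := by exact_mod_cast hl
      push_cast at this
      linarith
    calc (n : ℝ) ≤ 2 * N * (2 * l) ^ d := h1
      _ ≤ (2 * N) ^ d * (2 * l) ^ d := by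
          gcongr
          exact le_self_pow₀ (by linarith) hd.ne'
      _ = (4 * N * l) ^ d := by rw [← mul_pow]; ring
  by_cases hsmall : n ≤ 2 * (N * (2 * (l₀ + 1)) ^ d)
  · refine (hcrude _ hsmall).trans (pow_le_pow_left₀ (by positivity) ?_ d)
    push_cast
    have h2 : (l₀ : ℝ) + 1 ≤ C + Real.log b + (l₀ + 1) + 1 - Real.log τ := by linarith
    have h3 : (0 : ℝ) ≤ l₀ + 1 := by positivity
    calc 4 * (N : ℝ) * (l₀ + 1) ≤ 128 * N * (l₀ + 1) := by gcongr; norm_num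
      _ ≤ _ := by gcongr
  · obtain ⟨l, hl, hln, hln'⟩ : ∃ l, l₀ + 1 ≤ l ∧ 2 * (N * (2 * l) ^ d) ≤ n ∧
        n < 2 * (N * (2 * (l + 1)) ^ d) := by
      by_contra! hcon
      have hall : ∀ l, l₀ + 1 ≤ l → 2 * (N * (2 * l) ^ d) ≤ n := fun l hl =>
        Nat.le_induction (by omega) (fun k hk ih => hcon k hk ih) l hl
      have h1 := hall (n + l₀ + 1) (by omega)
      have h2 : 2 * (n + l₀ + 1) ≤ (2 * (n + l₀ + 1)) ^ d := Nat.le_self_pow hd.ne' _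
      have h3 : (2 * (n + l₀ + 1)) ^ d ≤ N * (2 * (n + l₀ + 1)) ^ d :=
        Nat.le_mul_of_pos_left _ hN
      omega
    have hl0 : (1 : ℝ) ≤ l := by exact_mod_cast (by omega : 1 ≤ l)
    have hnl : (n : ℝ) ≤ (8 * N * l) ^ d := by
      refine (hcrude _ hln'.le).trans (pow_le_pow_left₀ (by positivity) ?_ d)
      push_cast
      nlinarith [mul_le_mul_of_nonneg_left hl0 (by linarith : (0 : ℝ) ≤ N)]
    refine hnl.trans (pow_le_pow_left₀ (by positivity) ?_ d)
    have hn0 : (0 : ℝ) < n := by exact_mod_cast hn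
    have hlog := Real.log_le_log (by positivity) (h l (by omega) (by omega) hln)
    rw [Real.log_mul (by positivity) (by positivity), Real.log_pow, Real.log_pow, Real.log_pow,
      Real.log_mul hn0.ne' (by positivity), one_div, Real.log_inv] at hlog
    have hlogn : Real.log n ≤ d * Real.log (8 * N * l) := by
      rw [← Real.log_pow]
      exact Real.log_le_log hn0 hnl
    have hloga' : Real.log (8 * N * l) ≤ Real.log a + 8 * N * l / a := by
      have h1 := Real.log_le_sub_one_of_pos (show 0 < 8 * N * l / a by positivity)
      rw [Real.log_div (by positivity) (by positivity)] at h1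
      linarith
    have hterm : (d : ℝ) * (8 * N * l / a) = l / 8 := by
      rw [ha]; field_simp; norm_num
    have hdlog : (d : ℝ) * Real.log (8 * N * l) ≤ d * Real.log a + l / 8 := by
      rw [← hterm, ← mul_add]
      gcongr
    have hlog2 : (l : ℝ) * (1 / 2) ≤ l * Real.log 2 := by
      gcongr
      linarith [Real.log_two_gt_d9]
    push_cast at hlog
    have hfin : (l : ℝ) ≤ 16 * (C - Real.log τ) := by
      rw [hC]; linarith
    calc 8 * (N : ℝ) * l ≤ 8 * N * (16 * (C - Real.log τ)) := by gcongr
      _ = 128 * N * (C - Real.log τ) := by ring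
      _ ≤ _ := by gcongr; linarith [(Nat.cast_nonneg l₀ : (0 : ℝ) ≤ l₀)]

/-- Size of the output of the `P`-greedy algorithm with admissible error `α / T^q` for
kernels of infinite smoothness: if `D ≥ 2` is the smallest positive integer `n` such that
`sup_{x ∈ Ω̂} P_{(ξ₁,…,ξ_n)}(x) < α / T^q`, then
`D ≤ 1 + (C₂ (C₁ + q log T - log α))^d` for constants `C₁, C₂ > 0` depending only on
`d, K, Ω`. -/
theorem stmt_3 (d : ℕ) (hd : 0 < d) (Ω : Set (EuclideanSpace ℝ (Fin d)))
    (hΩne : Ω.Nonempty)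
    (K : EuclideanSpace ℝ (Fin d) → EuclideanSpace ℝ (Fin d) → ℝ)
    (hsym : ∀ x y, K x y = K y x)
    (hpd : ∀ (n : ℕ) (x : Fin n → EuclideanSpace ℝ (Fin d)), (∀ i, x i ∈ Ω) →
      Function.Injective x → (Matrix.of fun i j => K (x i) (x j)).PosDef)
    (a₀ : EuclideanSpace ℝ (Fin d)) (r₀ : ℝ) (hr₀ : 0 < r₀)
    (hΩcube : Ω = {x : EuclideanSpace ℝ (Fin d) | ∀ i, |x i - a₀ i| ≤ r₀})
    (φ : ℝ → ℝ) (hKφ : ∀ x ∈ Ω, ∀ y ∈ Ω, K x y = φ ‖x - y‖)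
    (l₀ : ℕ) (hl₀ : 0 < l₀) (M : ℝ) (hM : 0 < M)
    (hϕsmooth : ContDiffOn ℝ (⊤ : ℕ∞) (fun r : ℝ => φ (Real.sqrt r)) (Set.Ici 0))
    (hϕbd : ∀ l : ℕ, l₀ ≤ l → ∀ r : ℝ, 0 ≤ r →
      |iteratedDerivWithin l (fun r : ℝ => φ (Real.sqrt r)) (Set.Ici 0) r| ≤
        (l.factorial : ℝ) * M ^ l) :
    ∃ C₁ : ℝ, 0 < C₁ ∧ ∃ C₂ : ℝ, 0 < C₂ ∧
      ∀ Ωh : Set (EuclideanSpace ℝ (Fin d)), Ωh ⊆ Ω →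
        ∀ ξ : ℕ → EuclideanSpace ℝ (Fin d), IsPGreedySeq K Ωh ξ →
          ∀ α q : ℝ, 0 < α → 0 < q → ∀ T : ℕ, 0 < T →
            ∀ D : ℕ, 2 ≤ D →
              IsLeast {n : ℕ | 0 < n ∧
                sSup ((fun x => powerFunction K (fun i : Fin n => ξ i.1) x) '' Ωh) <
                  α / (T : ℝ) ^ q} D →
              (D : ℝ) ≤ 1 + (C₂ * (C₁ + q * Real.log T - Real.log α)) ^ d := by
  have hbound : Bornology.IsBounded Ω := by
    refine (Metric.isBounded_closedBall (x := a₀) (r := Real.sqrt (d * r₀ ^ 2))).subset ?_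
    intro x hx
    rw [hΩcube] at hx
    rw [Metric.mem_closedBall, EuclideanSpace.dist_eq]
    refine Real.sqrt_le_sqrt ?_
    calc ∑ i, dist (x i) (a₀ i) ^ 2 ≤ ∑ _i : Fin d, r₀ ^ 2 :=
          Finset.sum_le_sum fun i _ => pow_le_pow_left₀ dist_nonneg (hx i) 2
      _ = d * r₀ ^ 2 := by simp
  set b : ℝ := max 1 (φ 0) with hb
  have hb1 : 1 ≤ b := le_max_left _ _
  have hKb : ∀ x ∈ Ω, K x x ≤ b := fun x hx => by
    rw [hKφ x hx x hx, sub_self, norm_zero]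
    exact le_max_right _ _
  obtain ⟨N, hN, hdecay⟩ := exists_pow_four_le_of_le_powerFunction hbound K hsym hpd hKφ hM
    hϕsmooth hϕbd hb1 hKb
  obtain ⟨C₁, hC₁, C₂, hC₂, hcount⟩ := exists_card_le_of_pow_four_le (l₀ := l₀) hd hN hb1
  refine ⟨C₁, hC₁, C₂, hC₂, fun Ωh hΩh ξ ⟨hξ, hinj, hξ0, hgreedy⟩ α q hα hq T hT D hD hleast => ?_⟩
  have hT0 : (0 : ℝ) < T := by exact_mod_cast hT
  have hTq : (0 : ℝ) < (T : ℝ) ^ q := Real.rpow_pos_of_pos hT0 q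
  have hτ : 0 < α / (T : ℝ) ^ q := div_pos hα hTq
  have hξΩ : ∀ n, ξ n ∈ Ω := fun n => hΩh (hξ n)
  have hpos : ∀ m, 0 < m → m < D →
      α / (T : ℝ) ^ q ≤ powerFunction K (fun i : Fin m => ξ i.1) (ξ m) := by
    intro m hm hmD
    have hnot : ¬ sSup ((fun x => powerFunction K (fun i : Fin m => ξ i.1) x) '' Ωh) <
        α / (T : ℝ) ^ q := fun h => hmD.not_ge (hleast.2 ⟨hm, h⟩)
    refine (not_lt.1 hnot).trans (csSup_le ⟨_, Set.mem_image_of_mem _ (hξ 0)⟩ ?_)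
    rintro _ ⟨x, hx, rfl⟩
    exact hgreedy m hm x hx
  have hsqrt : α / (T : ℝ) ^ q ≤ Real.sqrt (K (ξ 0) (ξ 0)) :=
    (hpos 1 one_pos (by omega)).trans <|
      (powerFunction_le_sqrt K _ _ (hpd 1 _ (fun i => hξΩ _)
        (hinj.comp Fin.val_injective))).trans (Real.sqrt_le_sqrt (hξ0 _ (hξ 1)))
  have hall : ∀ m < D, α / (T : ℝ) ^ q ≤ powerFunction K (fun i : Fin m => ξ i.1) (ξ m) := by
    intro m hmD
    rcases m.eq_zero_or_pos with rfl | hm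
    · simpa [powerFunction] using hsqrt
    · exact hpos m hm hmD
  have hτb : α / (T : ℝ) ^ q ≤ b := by
    refine hsqrt.trans ((Real.sqrt_le_sqrt (hKb _ (hξΩ 0))).trans ?_)
    rw [Real.sqrt_le_left (by linarith)]
    nlinarith
  have hfinal := hcount D _ (by omega) hτ hτb fun l hl hl1 hln =>
    hdecay ξ hξΩ hinj l D hl hl1 (by omega) hln _ hτ hall
  rw [Real.log_div hα.ne' hTq.ne', Real.log_rpow hT0] at hfinal
  have heq : C₁ - (Real.log α - q * Real.log T) = C₁ + q * Real.log T - Real.log α := by ring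
  rw [heq] at hfinal
  linarith
end

section
/- Let A ⊆ Ω, let X = (x₁,…,x_D) be a finite tuple of pairwise distinct points of Ω, and let 𝔢 > 0. Assume K(y,y) ≤ 1 for all y ∈ A and P_X(x) ≤ 𝔢 for all x ∈ A. Then for all x, y ∈ A: |K(x,y) − k_X(x)ᵀ K_X⁻¹ k_X(y)| ≤ 𝔢. (This is the uniform kernel-approximation bound: k_X(x)ᵀ K_X⁻¹ k_X(y) equals ⟨x̃, ỹ⟩ for the Newton-basis feature map x̃.) -/
open Matrix

/-- A kernel that is positive definite on tuples of distinct points is positive semidefinite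
on every finite family of points, repetitions allowed. -/
theorem posSemidef_kernel_family {Ω ι : Type*} [Finite ι] {K : Ω → Ω → ℝ}
    (hpd : ∀ (n : ℕ) (x : Fin n → Ω), Function.Injective x →
      (Matrix.of fun i j => K (x i) (x j)).PosDef) (p : ι → Ω) :
    (Matrix.of fun i j => K (p i) (p j)).PosSemidef := by
  obtain ⟨n, ⟨f⟩⟩ := Finite.exists_equiv_fin (Set.range p)
  have h := hpd n (fun i => (f.symm i : Ω)) (Subtype.val_injective.comp f.symm.injective)
  have h' := h.posSemidef.submatrix fun i : ι => f ⟨p i, i, rfl⟩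
  simpa [Matrix.submatrix] using h'

/-- The residual kernel `K(x,y) - k_X(x)ᵀ K_X⁻¹ k_X(y)` is positive semidefinite. -/
theorem posSemidef_residual_kernel {Ω ι : Type*} [Finite ι] {K : Ω → Ω → ℝ}
    (hsym : ∀ x y, K x y = K y x)
    (hpd : ∀ (n : ℕ) (x : Fin n → Ω), Function.Injective x →
      (Matrix.of fun i j => K (x i) (x j)).PosDef)
    {D : ℕ} {X : Fin D → Ω} (hX : Function.Injective X) (p : ι → Ω) :
    (Matrix.of fun i j => K (p i) (p j) - (fun k => K (p i) (X k)) ⬝ᵥ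
      ((Matrix.of fun k l => K (X k) (X l))⁻¹ *ᵥ fun k => K (p j) (X k))).PosSemidef := by
  have hA := hpd D X hX
  have := hA.isUnit.invertible
  have h := posSemidef_kernel_family hpd (Sum.elim X p)
  have hblocks : (Matrix.of fun i j => K (Sum.elim X p i) (Sum.elim X p j)) =
      Matrix.fromBlocks (Matrix.of fun k l => K (X k) (X l))
        (Matrix.of fun k j => K (X k) (p j)) (Matrix.of fun k j => K (X k) (p j))ᴴ
        (Matrix.of fun i j => K (p i) (p j)) := by
    ext (i | i) (j | j) <;> simp [hsym (p _) (X _)]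
  rw [hblocks, Matrix.PosDef.fromBlocks₁₁ _ _ hA] at h
  rw [Matrix.mul_assoc] at h
  refine (congrArg Matrix.PosSemidef ?_).mp h
  ext i j
  simp [Matrix.mul_apply, dotProduct, mulVec, hsym (p _) (X _)]

/-- Uniform kernel approximation: if `K(y,y) ≤ 1` on `A` and the power function of the
tuple `X` is at most `𝔢` on `A`, then `|K(x,y) - k_X(x)ᵀ K_X⁻¹ k_X(y)| ≤ 𝔢` on `A × A`. -/
theorem stmt_4 {Ω : Type*} (K : Ω → Ω → ℝ)
    (hsym : ∀ x y, K x y = K y x)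
    (hpd : ∀ (n : ℕ) (x : Fin n → Ω), Function.Injective x →
      (Matrix.of fun i j => K (x i) (x j)).PosDef)
    (A : Set Ω) {D : ℕ} (X : Fin D → Ω) (hX : Function.Injective X)
    (e : ℝ) (he : 0 < e)
    (hbound : ∀ y ∈ A, K y y ≤ 1)
    (hP : ∀ x ∈ A, powerFunction K X x ≤ e) :
    ∀ x ∈ A, ∀ y ∈ A,
      |K x y - (fun i => K x (X i)) ⬝ᵥ
        ((Matrix.of fun i j => K (X i) (X j))⁻¹ *ᵥ fun i => K y (X i))| ≤ e := by
  intro x hx y hy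
  have hS := posSemidef_residual_kernel hsym hpd hX ![x, y]
  have hdet := hS.det_nonneg
  have hxx := hS.diag_nonneg (i := 0)
  have hxy := hS.isHermitian.apply 0 1
  have hyy : 0 ≤ (fun i => K y (X i)) ⬝ᵥ
      ((Matrix.of fun i j => K (X i) (X j))⁻¹ *ᵥ fun i => K y (X i)) := by
    simpa using (hpd D X hX).inv.posSemidef.dotProduct_mulVec_nonneg fun i => K y (X i)
  have hPx := (Real.sqrt_le_left he.le).mp (hP x hx)
  have hKy := hbound y hy
  rw [Matrix.det_fin_two] at hdet
  simp only [Matrix.of_apply, Matrix.cons_val_zero, Matrix.cons_val_one, star_trivial]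
    at hdet hxx hxy
  rw [hxy] at hdet
  refine abs_le_of_sq_le_sq ?_ he.le
  nlinarith
end

section
/- Let T ∈ ℤ_{>0}, λ > 0, 𝔢 ≥ 0, and let K and K̃ be real symmetric positive semidefinite T×T matrices such that |K_{ij} − K̃_{ij}| ≤ 𝔢 for all 1 ≤ i, j ≤ T. Then log det(1_T + λ⁻¹ K̃) ≤ log det(1_T + λ⁻¹ K) + 𝔢 · T^{3/2} / λ, where 1_T denotes the T×T identity matrix. -/
open Matrix in
lemma Matrix.PosDef.log_det_le_trace_sub_card {n : Type*} [Fintype n] [DecidableEq n]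
    {P : Matrix n n ℝ} (hP : P.PosDef) : Real.log P.det ≤ P.trace - Fintype.card n := by
  rw [hP.isHermitian.det_eq_prod_eigenvalues, hP.isHermitian.trace_eq_sum_eigenvalues]
  simp only [RCLike.ofReal_real_eq_id, id_eq]
  rw [Real.log_prod fun i _ => (hP.eigenvalues_pos i).ne']
  calc ∑ i, Real.log (hP.isHermitian.eigenvalues i)
      ≤ ∑ i, (hP.isHermitian.eigenvalues i - 1) :=
        Finset.sum_le_sum fun i _ => Real.log_le_sub_one_of_pos (hP.eigenvalues_pos i)
    _ = _ := by simp

open Matrix in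
/-- Concavity of `log det`: the graph lies below its tangent at `A`. -/
lemma Matrix.PosDef.log_det_le_log_det_add_trace {n : Type*} [Fintype n] [DecidableEq n]
    {A B : Matrix n n ℝ} (hA : A.PosDef) (hB : B.PosDef) :
    Real.log B.det ≤ Real.log A.det + (A⁻¹ * (B - A)).trace := by
  obtain ⟨C, hC⟩ : ∃ C : Matrix n n ℝ, A⁻¹ = Cᴴ * C := by
    open scoped MatrixOrder in
    exact CStarAlgebra.nonneg_iff_eq_star_mul_self.mp hA.inv.posSemidef.nonneg
  have hAdet := hA.det_pos
  have hMdet : A⁻¹.det = A.det⁻¹ := by rw [det_nonsing_inv, Ring.inverse_eq_inv']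
  have hdet : (C * B * Cᴴ).det = A.det⁻¹ * B.det := by
    rw [← hMdet, hC]
    simp only [det_mul]
    ring
  have hP : (C * B * Cᴴ).PosDef := by
    open scoped MatrixOrder in
    refine (hB.posSemidef.mul_mul_conjTranspose_same C).posDef_iff_det_ne_zero.mpr ?_
    rw [hdet]
    exact (mul_pos (inv_pos.mpr hAdet) hB.det_pos).ne'
  have key := hP.log_det_le_trace_sub_card
  rw [hdet, Real.log_mul (inv_pos.mpr hAdet).ne' hB.det_pos.ne', Real.log_inv,
    trace_mul_cycle, ← hC] at key
  rw [mul_sub, nonsing_inv_mul A hAdet.ne'.isUnit, trace_sub, trace_one]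
  linarith

open Matrix in
lemma Matrix.PosSemidef.sum_sq_inv_one_add_le_card {n : Type*} [Fintype n] [DecidableEq n]
    {K : Matrix n n ℝ} (hK : K.PosSemidef) :
    ∑ i, ∑ j, ((1 + K)⁻¹ i j) ^ 2 ≤ Fintype.card n := by
  have hA : (1 + K).PosDef := PosDef.one.add_posSemidef hK
  set M := (1 + K)⁻¹ with hM
  have hMH : Mᴴ = M := hA.inv.isHermitian
  have hsum : ∑ i, ∑ j, (M i j) ^ 2 = (M * M).trace := by
    simp only [trace, diag_apply, mul_apply]
    refine Finset.sum_congr rfl fun i _ => Finset.sum_congr rfl fun j _ => ?_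
    have : M j i = M i j := by simpa using congrFun (congrFun hMH i) j
    rw [this, sq]
  have hMA : M * (1 + K) = 1 := nonsing_inv_mul _ hA.det_pos.ne'.isUnit
  have h1 : M = M * M + M * K * M := by
    calc M = M * (1 + K) * M := by rw [hMA, one_mul]
      _ = _ := by noncomm_ring
  have h2 : 0 ≤ (M * K * M).trace := by
    have := (hK.mul_mul_conjTranspose_same M).trace_nonneg
    rwa [hMH] at this
  have h3 : 0 ≤ ((1 - M) * (1 - M)).trace := by
    have := (posSemidef_conjTranspose_mul_self (1 - M)).trace_nonneg
    rwa [conjTranspose_sub, conjTranspose_one, hMH] at this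
  have h4 : M.trace = (M * M).trace + (M * K * M).trace := by
    rw [← trace_add, ← h1]
  have h5 : ((1 - M) * (1 - M)).trace = Fintype.card n - 2 * M.trace + (M * M).trace := by
    simp only [mul_sub, sub_mul, one_mul, mul_one, trace_sub, trace_one]
    ring
  rw [hsum]
  linarith

lemma Finset.sum_sum_abs_le_rpow_of_sum_sq_le {n : Type*} [Fintype n] (M : n → n → ℝ)
    (h : ∑ i, ∑ j, (M i j) ^ 2 ≤ Fintype.card n) :
    ∑ i, ∑ j, |M i j| ≤ (Fintype.card n : ℝ) ^ ((3 : ℝ) / 2) := by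
  have hc : (0 : ℝ) ≤ Fintype.card n := Nat.cast_nonneg _
  refine le_of_sq_le_sq ?_ (Real.rpow_nonneg hc _)
  have hr : ((Fintype.card n : ℝ) ^ ((3 : ℝ) / 2)) ^ 2 = (Fintype.card n : ℝ) ^ 3 := by
    rw [← Real.rpow_natCast, ← Real.rpow_mul hc, ← Real.rpow_natCast]
    norm_num
  rw [hr]
  have hcs := sq_sum_le_card_mul_sum_sq (s := (Finset.univ : Finset (n × n)))
    (f := fun p => |M p.1 p.2|)
  simp only [sq_abs, Fintype.sum_prod_type, Finset.card_univ, Fintype.card_prod,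
    Nat.cast_mul] at hcs
  calc _ ≤ _ := hcs
    _ ≤ (Fintype.card n : ℝ) * Fintype.card n * Fintype.card n := by gcongr
    _ = _ := by ring

/-- Let `T ∈ ℤ_{>0}`, `λ > 0`, `𝔢 ≥ 0`, and let `K`, `K̃` be real symmetric positive
semidefinite `T × T` matrices with `|K i j - K̃ i j| ≤ 𝔢` entrywise.  Then
`log det (1 + λ⁻¹ K̃) ≤ log det (1 + λ⁻¹ K) + 𝔢 T^{3/2} / λ`. -/
theorem stmt_5 (T : ℕ) (hT : 0 < T) (lam e : ℝ) (hlam : 0 < lam) (he : 0 ≤ e)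
    (K Kt : Matrix (Fin T) (Fin T) ℝ) (hK : K.PosSemidef) (hKt : Kt.PosSemidef)
    (happ : ∀ i j, |K i j - Kt i j| ≤ e) :
    Real.log ((1 + lam⁻¹ • Kt).det) ≤
      Real.log ((1 + lam⁻¹ • K).det) + e * (T : ℝ) ^ ((3 : ℝ) / 2) / lam := by
  have hl : 0 ≤ lam⁻¹ := (inv_pos.mpr hlam).le
  have hA := Matrix.PosDef.one.add_posSemidef (hK.smul hl)
  have hB := Matrix.PosDef.one.add_posSemidef (hKt.smul hl)
  refine (hA.log_det_le_log_det_add_trace hB).trans (add_le_add_right ?_ _)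
  have hM := Finset.sum_sum_abs_le_rpow_of_sum_sq_le _ (hK.smul hl).sum_sq_inv_one_add_le_card
  rw [Fintype.card_fin] at hM
  set M := (1 + lam⁻¹ • K)⁻¹
  calc (M * (1 + lam⁻¹ • Kt - (1 + lam⁻¹ • K))).trace
      = ∑ i, ∑ j, M i j * (lam⁻¹ * (Kt j i - K j i)) := by
        rw [add_sub_add_left_eq_sub, ← smul_sub]
        simp only [Matrix.trace, Matrix.diag_apply, Matrix.mul_apply, Matrix.smul_apply,
          Matrix.sub_apply, smul_eq_mul]
    _ ≤ ∑ i, ∑ j, |M i j| * (lam⁻¹ * e) := by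
        refine Finset.sum_le_sum fun i _ => Finset.sum_le_sum fun j _ => ?_
        refine (le_abs_self _).trans ?_
        rw [abs_mul, abs_mul, abs_of_nonneg hl, abs_sub_comm]
        gcongr
        exact happ j i
    _ = (∑ i, ∑ j, |M i j|) * (lam⁻¹ * e) := by simp only [Finset.sum_mul]
    _ ≤ (T : ℝ) ^ ((3 : ℝ) / 2) * (lam⁻¹ * e) := by gcongr
    _ = e * (T : ℝ) ^ ((3 : ℝ) / 2) / lam := by ring
end

section
/- Let A and B be real symmetric n×n matrices. Let a₁ ≤ a₂ ≤ … ≤ a_n be the eigenvalues of A and b₁ ≤ b₂ ≤ … ≤ b_n the eigenvalues of B, each listed with multiplicity in nondecreasing order. Then Σ_{i=1}^{n} |a_i − b_i|² ≤ ‖A − B‖_F², where ‖M‖_F := sqrt(Σ_{i,j} M_{ij}²) is the Frobenius norm. -/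
open Polynomial

theorem Monovary.sum_mul_mul_le_of_mem_doublyStochastic {n : Type*} [Fintype n] [DecidableEq n]
    {a b : n → ℝ} (hab : Monovary a b) {D : Matrix n n ℝ} (hD : D ∈ doublyStochastic ℝ n) :
    ∑ i, ∑ j, a i * D i j * b j ≤ ∑ i, a i * b i := by
  obtain ⟨w, hw, hw1, rfl⟩ := exists_eq_sum_perm_of_mem_doublyStochastic hD
  calc ∑ i, ∑ j, a i * (∑ σ, w σ • σ.permMatrix ℝ) i j * b j
      = ∑ i, ∑ σ, w σ * (a i * b (σ i)) := by
        refine Finset.sum_congr rfl fun i _ => ?_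
        simp only [Matrix.sum_apply, Matrix.smul_apply, Finset.mul_sum, Finset.sum_mul]
        rw [Finset.sum_comm]
        refine Finset.sum_congr rfl fun σ _ => ?_
        simp [PEquiv.toMatrix_apply, Equiv.toPEquiv_apply, mul_left_comm, mul_assoc]
    _ = ∑ σ, w σ * ∑ i, a i * b (σ i) := by
        rw [Finset.sum_comm]
        simp only [Finset.mul_sum]
    _ ≤ ∑ σ, w σ * ∑ i, a i * b i :=
        Finset.sum_le_sum fun σ _ =>
          mul_le_mul_of_nonneg_left hab.sum_mul_comp_perm_le_sum_mul (hw σ)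
    _ = ∑ i, a i * b i := by rw [← Finset.sum_mul, hw1, one_mul]

namespace Matrix

section

variable {n : Type*} [Fintype n] [DecidableEq n]

theorem of_sq_mem_doublyStochastic {W : Matrix n n ℝ} (hW : W ∈ orthogonalGroup n ℝ) :
    of (fun i j => W i j ^ 2) ∈ doublyStochastic ℝ n := by
  refine mem_doublyStochastic_iff_sum.2 ⟨fun i j => sq_nonneg _, fun i => ?_, fun j => ?_⟩
  · simpa [mul_apply, sq] using congr_fun₂ ((mem_orthogonalGroup_iff n ℝ).1 hW) i i
  · simpa [mul_apply, sq] using congr_fun₂ ((mem_orthogonalGroup_iff' n ℝ).1 hW) j j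

theorem trace_conj_diagonal_mul_conj_diagonal_le {a b : n → ℝ} (hab : Monovary a b)
    {U V : Matrix n n ℝ} (hU : U ∈ orthogonalGroup n ℝ) (hV : V ∈ orthogonalGroup n ℝ) :
    ((U * diagonal a * star U) * (V * diagonal b * star V)).trace ≤ ∑ i, a i * b i := by
  have hW : star U * V ∈ orthogonalGroup n ℝ := mul_mem (Unitary.star_mem hU) hV
  convert hab.sum_mul_mul_le_of_mem_doublyStochastic (of_sq_mem_doublyStochastic hW) using 1
  calc _ = (diagonal a * (star U * V) * diagonal b * star (star U * V)).trace := by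
        rw [Matrix.mul_assoc U, Matrix.mul_assoc, trace_mul_comm]
        simp only [star_mul, star_star, Matrix.mul_assoc]
    _ = _ := by
        simp only [trace, diag_apply]
        refine Finset.sum_congr rfl fun i _ => ?_
        rw [mul_apply]
        refine Finset.sum_congr rfl fun j _ => ?_
        rw [mul_diagonal, diagonal_mul, star_apply, of_apply,
          star_trivial ((star U * V) i j)]
        ring

theorem trace_conj_diagonal_mul_self (a : n → ℝ) {U : Matrix n n ℝ}
    (hU : U ∈ orthogonalGroup n ℝ) :
    ((U * diagonal a * star U) * (U * diagonal a * star U)).trace = ∑ i, a i ^ 2 := by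
  have h : star U * U = 1 := Unitary.star_mul_self_of_mem hU
  calc _ = (U * (diagonal a * (star U * U) * diagonal a * star U)).trace := by
        simp only [Matrix.mul_assoc]
    _ = ∑ i, a i ^ 2 := by
        rw [trace_mul_comm, h, Matrix.mul_one, Matrix.mul_assoc, h, Matrix.mul_one,
          diagonal_mul_diagonal, trace_diagonal]
        simp only [sq]

end

theorem IsSymm.trace_mul_eq_sum {n : Type*} [Fintype n] {A B : Matrix n n ℝ} (hB : B.IsSymm) :
    (A * B).trace = ∑ i, ∑ j, A i j * B i j := by
  simp only [trace, diag_apply, mul_apply]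
  exact Finset.sum_congr rfl fun i _ => Finset.sum_congr rfl fun j _ => by rw [hB.apply]

theorem IsSymm.exists_eq_conj_diagonal_of_charpoly_eq {n : ℕ} {A : Matrix (Fin n) (Fin n) ℝ}
    (hA : A.IsSymm) {a : Fin n → ℝ} (ha : Monotone a) (hca : A.charpoly = ∏ i, (X - C (a i))) :
    ∃ U ∈ orthogonalGroup (Fin n) ℝ, A = U * diagonal a * star U := by
  have hH : A.IsHermitian := by rwa [IsHermitian, conjTranspose_eq_transpose_of_trivial]
  set e := hH.eigenvalues
  set U : Matrix (Fin n) (Fin n) ℝ := (hH.eigenvectorUnitary : Matrix (Fin n) (Fin n) ℝ)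
  have hU : U ∈ orthogonalGroup (Fin n) ℝ := hH.eigenvectorUnitary.2
  have hspec : A = U * diagonal e * star U := hH.spectral_theorem
  have hroots : Finset.univ.val.map a = Finset.univ.val.map e := by
    rw [← roots_multiset_prod_X_sub_C (Finset.univ.val.map a), Multiset.map_map]
    exact (congrArg roots hca).symm.trans hH.roots_charpoly_eq_eigenvalues
  have hperm : (List.ofFn a).Perm (List.ofFn e) := by
    simpa only [Fin.univ_val_map, Multiset.coe_eq_coe] using hroots
  obtain rfl : a = e ∘ Tuple.sort e := List.ofFn_injective <|
    (hperm.trans ((Tuple.sort e).ofFn_comp_perm e).symm).eq_of_sortedLE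
      ha.sortedLE_ofFn (Tuple.monotone_sort e).sortedLE_ofFn
  refine ⟨U.submatrix id (Tuple.sort e), ?_, ?_⟩
  · rw [mem_orthogonalGroup_iff, transpose_submatrix, submatrix_mul_equiv, submatrix_id_id]
    exact (mem_orthogonalGroup_iff _ _).1 hU
  · rw [← submatrix_diagonal_equiv, star_eq_conjTranspose, conjTranspose_submatrix,
      submatrix_mul_equiv, submatrix_mul_equiv, submatrix_id_id]
    exact hspec

end Matrix

/-- Wielandt–Hoffman inequality for real symmetric matrices: if `a` and `b` enumerate the
eigenvalues (with multiplicity, in nondecreasing order) of real symmetric matrices `A` and `B`,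
then `∑ i, |a i - b i|² ≤ ‖A - B‖_F²`. -/
theorem stmt_6 {n : ℕ} (A B : Matrix (Fin n) (Fin n) ℝ)
    (hA : A.IsSymm) (hB : B.IsSymm)
    (a b : Fin n → ℝ) (ha : Monotone a) (hb : Monotone b)
    (hca : A.charpoly = ∏ i, (X - C (a i)))
    (hcb : B.charpoly = ∏ i, (X - C (b i))) :
    ∑ i, |a i - b i| ^ 2 ≤ ∑ i, ∑ j, ((A - B) i j) ^ 2 := by
  obtain ⟨U, hU, hAU⟩ := hA.exists_eq_conj_diagonal_of_charpoly_eq ha hca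
  obtain ⟨V, hV, hBV⟩ := hB.exists_eq_conj_diagonal_of_charpoly_eq hb hcb
  have hAA := Matrix.trace_conj_diagonal_mul_self a hU
  have hBB := Matrix.trace_conj_diagonal_mul_self b hV
  have hAB := Matrix.trace_conj_diagonal_mul_conj_diagonal_le (ha.monovary hb) hU hV
  rw [← hAU, hA.trace_mul_eq_sum] at hAA
  rw [← hBV, hB.trace_mul_eq_sum] at hBB
  rw [← hAU, ← hBV, hB.trace_mul_eq_sum] at hAB
  have hl : ∑ i, |a i - b i| ^ 2 = ∑ i, a i ^ 2 + ∑ i, b i ^ 2 - 2 * ∑ i, a i * b i := by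
    rw [Finset.mul_sum, ← Finset.sum_add_distrib, ← Finset.sum_sub_distrib]
    exact Finset.sum_congr rfl fun i _ => by rw [sq_abs]; ring
  have hr : ∑ i, ∑ j, ((A - B) i j) ^ 2 = ∑ i, ∑ j, A i j * A i j + ∑ i, ∑ j, B i j * B i j
      - 2 * ∑ i, ∑ j, A i j * B i j := by
    simp only [Finset.mul_sum, ← Finset.sum_add_distrib, ← Finset.sum_sub_distrib]
    exact Finset.sum_congr rfl fun i _ => Finset.sum_congr rfl fun j _ => by
      rw [Matrix.sub_apply]; ring
  linarith
end

section
/- Let (Ψ, 𝒢, μ) be a probability space, η > 0, and X : Ψ → ℝ a random variable such that X and X² are integrable and η·X ≤ 1 almost surely. Then E[X] ≥ (1/η)·log(E[exp(η X)]) − (e − 2)·η·E[X²]. -/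
open MeasureTheory

/-- Quadratic upper bound for the exponential on `(-∞, 0]`. -/
theorem exp_le_quadratic_of_nonpos {y : ℝ} (hy : y ≤ 0) :
    Real.exp y ≤ 1 + y + y ^ 2 / 2 := by
  have h := Real.quadratic_le_exp_of_nonneg (neg_nonneg.mpr hy)
  have hmul : Real.exp y * Real.exp (-y) = 1 := by rw [← Real.exp_add]; simp
  have hpos : 0 < 1 + -y + (-y) ^ 2 / 2 := by nlinarith
  refine le_of_mul_le_mul_right ?_ hpos
  calc Real.exp y * (1 + -y + (-y) ^ 2 / 2) ≤ Real.exp y * Real.exp (-y) := by gcongr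
    _ = 1 := hmul
    _ ≤ (1 + y + y ^ 2 / 2) * (1 + -y + (-y) ^ 2 / 2) := by nlinarith [sq_nonneg (y ^ 2)]

/-- The Taylor series of `exp` at `0` with its first two terms removed. -/
theorem hasSum_exp_sub_one_sub (y : ℝ) :
    HasSum (fun n : ℕ => y ^ (n + 2) / (n + 2).factorial) (Real.exp y - 1 - y) := by
  have h : HasSum (fun n : ℕ => y ^ n / n.factorial) (Real.exp y) := by
    rw [Real.exp_eq_exp_ℝ]
    exact NormedSpace.expSeries_div_hasSum_exp y
  rw [← hasSum_nat_add_iff' 2] at h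
  simpa [Finset.sum_range_succ, sub_sub] using h

/-- Quadratic upper bound for the exponential on `(-∞, 1]`, with equality at `0` and `1`. -/
theorem exp_le_one_add_add_mul_sq {y : ℝ} (hy : y ≤ 1) :
    Real.exp y ≤ 1 + y + (Real.exp 1 - 2) * y ^ 2 := by
  rcases le_total y 0 with h0 | h0
  · have h1 := Real.quadratic_le_exp_of_nonneg (zero_le_one (α := ℝ))
    nlinarith [exp_le_quadratic_of_nonpos h0, sq_nonneg y]
  · have h := hasSum_le (fun n => ?_) (hasSum_exp_sub_one_sub y)
      ((hasSum_exp_sub_one_sub 1).mul_left (y ^ 2))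
    · linarith
    · rw [one_pow, mul_one_div]
      exact div_le_div_of_nonneg_right (pow_le_pow_of_le_one h0 hy (Nat.le_add_left 2 n))
        (Nat.cast_nonneg _)

/-- Let `(Ψ, 𝒢, μ)` be a probability space, `η > 0`, and `X : Ψ → ℝ` a random variable
such that `X` and `X²` are integrable and `η • X ≤ 1` almost surely.  Then
`E[X] ≥ (1/η) log (E[exp (η X)]) - (e - 2) η E[X²]`. -/
theorem stmt_7 {Ψ : Type*} [MeasurableSpace Ψ] (μ : Measure Ψ) [IsProbabilityMeasure μ]
    (η : ℝ) (hη : 0 < η) (X : Ψ → ℝ)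
    (hX : Integrable X μ) (hX2 : Integrable (fun ψ => X ψ ^ 2) μ)
    (hbd : ∀ᵐ ψ ∂μ, η * X ψ ≤ 1) :
    (1 / η) * Real.log (∫ ψ, Real.exp (η * X ψ) ∂μ)
      - (Real.exp 1 - 2) * η * (∫ ψ, X ψ ^ 2 ∂μ) ≤ ∫ ψ, X ψ ∂μ := by
  have hlin : Integrable (fun ψ => 1 + η * X ψ) μ := (integrable_const 1).add (hX.const_mul η)
  have hquad : Integrable (fun ψ => 1 + η * X ψ + (Real.exp 1 - 2) * η ^ 2 * X ψ ^ 2) μ :=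
    hlin.add (hX2.const_mul _)
  have hexp : Integrable (fun ψ => Real.exp (η * X ψ)) μ := by
    refine Integrable.of_bound
      (Real.continuous_exp.comp_aestronglyMeasurable (hX.const_mul η).aestronglyMeasurable)
      (Real.exp 1) ?_
    filter_upwards [hbd] with ψ hψ
    simpa using hψ
  have hle : ∫ ψ, Real.exp (η * X ψ) ∂μ
      ≤ 1 + η * ∫ ψ, X ψ ∂μ + (Real.exp 1 - 2) * η ^ 2 * ∫ ψ, X ψ ^ 2 ∂μ := by
    calc ∫ ψ, Real.exp (η * X ψ) ∂μ
        ≤ ∫ ψ, (1 + η * X ψ + (Real.exp 1 - 2) * η ^ 2 * X ψ ^ 2) ∂μ := by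
          refine integral_mono_ae hexp hquad ?_
          filter_upwards [hbd] with ψ hψ
          have := exp_le_one_add_add_mul_sq hψ
          rwa [mul_pow, ← mul_assoc] at this
      _ = _ := by
          rw [integral_add hlin (hX2.const_mul _),
            integral_add (integrable_const 1) (hX.const_mul η), integral_const_mul,
            integral_const_mul]
          simp
  have hlog := Real.log_le_sub_one_of_pos (integral_exp_pos hexp)
  rw [sub_le_iff_le_add, one_div, inv_mul_le_iff₀ hη]
  linarith
end

section
/- Let π_exp and q be probability distributions on A with Q(π_exp) positive definite, let γ ∈ (0,1), define p := γ·π_exp + (1−γ)·q and Q := Q(p), and let B ≥ 0 and g ∈ ℝ with |g| ≤ B. Then for every z ∈ A: Σ_{x∈A} q(x) · ( g · x̃(x)ᵀ Q⁻¹ x̃(z) )² ≤ (B²/(1−γ)) · x̃(z)ᵀ Q⁻¹ x̃(z). -/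
open Matrix

theorem dotProduct_sum_smul_vecMulVec_mulVec {A n : Type*} [Fintype A] [Fintype n]
    (emb : A → n → ℝ) (c : A → ℝ) (v : n → ℝ) :
    v ⬝ᵥ ((∑ x : A, c x • vecMulVec (emb x) (emb x)) *ᵥ v) = ∑ x : A, c x * (emb x ⬝ᵥ v) ^ 2 := by
  simp only [sum_mulVec, dotProduct_sum, smul_mulVec, dotProduct_smul, vecMulVec_mulVec]
  refine Finset.sum_congr rfl fun x _ => ?_
  simp [dotProduct_comm v (emb x), sq]

theorem posSemidef_sum_smul_vecMulVec {A n : Type*} [Fintype A] [Fintype n]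
    (emb : A → n → ℝ) (c : A → ℝ) (hc : ∀ x, 0 ≤ c x) :
    (∑ x : A, c x • vecMulVec (emb x) (emb x)).PosSemidef :=
  posSemidef_sum _ fun x _ => by
    have h : (vecMulVec (emb x) (emb x)).PosSemidef := by
      simpa using posSemidef_vecMulVec_self_star (emb x)
    exact h.smul (hc x)

/-- Variance bound for the EXP3 least-squares estimator: with `p = γ π_exp + (1-γ) q`,
`Q = Q(p)`, and `|g| ≤ B`, for every `z ∈ A`,
`∑_x q(x) (g x̃(x)ᵀ Q⁻¹ x̃(z))² ≤ (B²/(1-γ)) x̃(z)ᵀ Q⁻¹ x̃(z)`. -/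
theorem stmt_11 {A : Type*} [Fintype A] [Nonempty A] (D : ℕ) (hD : 0 < D)
    (emb : A → Fin D → ℝ)
    (πe q : A → ℝ)
    (hπe0 : ∀ x, 0 ≤ πe x) (hπe1 : ∀ x, πe x ≤ 1) (hπesum : ∑ x : A, πe x = 1)
    (hq0 : ∀ x, 0 ≤ q x) (hq1 : ∀ x, q x ≤ 1) (hqsum : ∑ x : A, q x = 1)
    (hQe : (∑ x : A, πe x • vecMulVec (emb x) (emb x)).PosDef)
    (γ : ℝ) (hγ0 : 0 < γ) (hγ1 : γ < 1)
    (p : A → ℝ) (hp : ∀ x, p x = γ * πe x + (1 - γ) * q x)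
    (Q : Matrix (Fin D) (Fin D) ℝ)
    (hQ : Q = ∑ x : A, p x • vecMulVec (emb x) (emb x))
    (B g : ℝ) (hB : 0 ≤ B) (hg : |g| ≤ B) :
    ∀ z : A, ∑ x : A, q x * (g * (emb x ⬝ᵥ (Q⁻¹ *ᵥ emb z))) ^ 2 ≤
      (B ^ 2 / (1 - γ)) * (emb z ⬝ᵥ (Q⁻¹ *ᵥ emb z)) := by
  have hγ : 0 < 1 - γ := sub_pos.2 hγ1
  have hQpos : Q.PosDef := by
    have h : Q = γ • (∑ x : A, πe x • vecMulVec (emb x) (emb x)) +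
        (1 - γ) • ∑ x : A, q x • vecMulVec (emb x) (emb x) := by
      simp only [hQ, hp, Finset.smul_sum, smul_smul, add_smul, Finset.sum_add_distrib]
    rw [h]
    exact (hQe.smul hγ0).add_posSemidef
      ((posSemidef_sum_smul_vecMulVec emb q hq0).smul hγ.le)
  intro z
  set w := Q⁻¹ *ᵥ emb z with hw
  have hQw : Q *ᵥ w = emb z := by
    rw [hw, mulVec_mulVec, mul_nonsing_inv _ hQpos.det_pos.ne'.isUnit, one_mulVec]
  have hquad : emb z ⬝ᵥ w = ∑ x : A, p x * (emb x ⬝ᵥ w) ^ 2 := by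
    rw [← dotProduct_sum_smul_vecMulVec_mulVec, ← hQ, hQw, dotProduct_comm]
  have hg2 : g ^ 2 ≤ B ^ 2 := sq_le_sq' (abs_le.1 hg).1 (abs_le.1 hg).2
  rw [hquad, Finset.mul_sum]
  refine Finset.sum_le_sum fun x _ => ?_
  have hqp : q x ≤ p x / (1 - γ) := by
    rw [le_div_iff₀ hγ, hp]
    nlinarith [mul_nonneg hγ0.le (hπe0 x)]
  calc q x * (g * (emb x ⬝ᵥ w)) ^ 2 = q x * (g ^ 2 * (emb x ⬝ᵥ w) ^ 2) := by rw [mul_pow]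
    _ ≤ p x / (1 - γ) * (B ^ 2 * (emb x ⬝ᵥ w) ^ 2) := by
      have := (hq0 x).trans hqp
      gcongr
    _ = B ^ 2 / (1 - γ) * (p x * (emb x ⬝ᵥ w) ^ 2) := by ring
end

section
/- Let π_exp and q be probability distributions on A with Q(π_exp) positive definite, let η > 0 and B > 0, let Γ := max_{x∈A} x̃(x)ᵀ Q(π_exp)⁻¹ x̃(x), set γ := η·B·Γ, and assume γ ∈ (0,1]. Define p := γ·π_exp + (1−γ)·q and Q := Q(p), and let g ∈ ℝ with |g| ≤ B. Then for all x, y ∈ A: η · | g · x̃(y)ᵀ Q⁻¹ x̃(x) | ≤ 1. -/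
open Matrix

section

variable {n : Type*} [Fintype n]

lemma Matrix.IsHermitian.dotProduct_mulVec_comm {M : Matrix n n ℝ} (hM : M.IsHermitian)
    (x y : n → ℝ) : x ⬝ᵥ (M *ᵥ y) = y ⬝ᵥ (M *ᵥ x) := by
  have hT : Mᵀ = M := by simpa using hM.eq
  rw [dotProduct_mulVec, ← mulVec_transpose, hT, dotProduct_comm]

lemma Matrix.PosSemidef.abs_dotProduct_mulVec_le {M : Matrix n n ℝ} (hM : M.PosSemidef)
    (x y : n → ℝ) :
    |y ⬝ᵥ (M *ᵥ x)| ≤ (x ⬝ᵥ (M *ᵥ x) + y ⬝ᵥ (M *ᵥ y)) / 2 := by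
  have hadd := hM.dotProduct_mulVec_nonneg (x + y)
  have hsub := hM.dotProduct_mulVec_nonneg (x - y)
  simp only [star_trivial, mulVec_add, mulVec_sub, dotProduct_add, dotProduct_sub,
    add_dotProduct, sub_dotProduct] at hadd hsub
  rw [hM.isHermitian.dotProduct_mulVec_comm x y] at hadd hsub
  rw [abs_le]
  constructor <;> linarith

/-- Inversion is antitone for the Loewner order, in terms of quadratic forms. -/
lemma Matrix.PosDef.mul_dotProduct_inv_mulVec_le [DecidableEq n] {M N : Matrix n n ℝ}
    (hM : M.PosDef) (hN : N.PosDef) {c : ℝ} (hc : 0 ≤ c) (hMN : (N - c • M).PosSemidef)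
    (x : n → ℝ) : c * (x ⬝ᵥ (N⁻¹ *ᵥ x)) ≤ x ⬝ᵥ (M⁻¹ *ᵥ x) := by
  set u := N⁻¹ *ᵥ x with hu
  set v := M⁻¹ *ᵥ x with hv
  have hNu : N *ᵥ u = x := by
    rw [hu, mulVec_mulVec, mul_nonsing_inv _ ((isUnit_iff_isUnit_det N).1 hN.isUnit), one_mulVec]
  have hMv : M *ᵥ v = x := by
    rw [hv, mulVec_mulVec, mul_nonsing_inv _ ((isUnit_iff_isUnit_det M).1 hM.isUnit), one_mulVec]
  have hle := hMN.dotProduct_mulVec_nonneg u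
  have hsq := hM.posSemidef.dotProduct_mulVec_nonneg (c • u - v)
  have hvu : v ⬝ᵥ (M *ᵥ u) = u ⬝ᵥ x := by
    rw [hM.isHermitian.dotProduct_mulVec_comm, hMv]
  simp only [star_trivial, sub_mulVec, smul_mulVec, mulVec_sub, mulVec_smul, dotProduct_sub,
    sub_dotProduct, smul_dotProduct, dotProduct_smul, smul_eq_mul, hNu, hMv, hvu] at hle hsq
  rw [dotProduct_comm x u, dotProduct_comm x v]
  nlinarith [mul_nonneg hc hle]

lemma Matrix.posSemidef_sum_smul_vecMulVec {A : Type*} [Fintype A] (w : A → ℝ)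
    (hw : ∀ a, 0 ≤ w a) (f : A → n → ℝ) :
    (∑ a, w a • vecMulVec (f a) (f a)).PosSemidef :=
  posSemidef_sum _ fun a _ ↦ by
    simpa using (posSemidef_vecMulVec_self_star (f a)).smul (hw a)

end

/-- Boundedness of the EXP3 loss estimates: with `Γ = max_x x̃(x)ᵀ Q(π_exp)⁻¹ x̃(x)`,
`γ := η B Γ ∈ (0,1]`, `p = γ π_exp + (1-γ) q`, `Q = Q(p)`, and `|g| ≤ B`, one has
`η |g x̃(y)ᵀ Q⁻¹ x̃(x)| ≤ 1` for all `x, y ∈ A`. -/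
theorem stmt_13 {A : Type*} [Fintype A] [Nonempty A] (D : ℕ) (hD : 0 < D)
    (emb : A → Fin D → ℝ)
    (πe q : A → ℝ)
    (hπe0 : ∀ x, 0 ≤ πe x) (hπe1 : ∀ x, πe x ≤ 1) (hπesum : ∑ x : A, πe x = 1)
    (hq0 : ∀ x, 0 ≤ q x) (hq1 : ∀ x, q x ≤ 1) (hqsum : ∑ x : A, q x = 1)
    (Qe : Matrix (Fin D) (Fin D) ℝ)
    (hQe : Qe = ∑ x : A, πe x • vecMulVec (emb x) (emb x))
    (hQepd : Qe.PosDef)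
    (η B : ℝ) (hη : 0 < η) (hB : 0 < B)
    (Γ : ℝ) (hΓ : Γ = Finset.univ.sup' Finset.univ_nonempty
      (fun x : A => emb x ⬝ᵥ (Qe⁻¹ *ᵥ emb x)))
    (γ : ℝ) (hγ : γ = η * B * Γ) (hγ0 : 0 < γ) (hγ1 : γ ≤ 1)
    (p : A → ℝ) (hp : ∀ x, p x = γ * πe x + (1 - γ) * q x)
    (Q : Matrix (Fin D) (Fin D) ℝ)
    (hQ : Q = ∑ x : A, p x • vecMulVec (emb x) (emb x))
    (g : ℝ) (hg : |g| ≤ B) :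
    ∀ x y : A, η * |g * (emb y ⬝ᵥ (Q⁻¹ *ᵥ emb x))| ≤ 1 := by
  intro x y
  have hQsub : Q - γ • Qe = (1 - γ) • ∑ a, q a • vecMulVec (emb a) (emb a) := by
    rw [hQ, hQe, sub_eq_iff_eq_add, Finset.smul_sum, Finset.smul_sum, ← Finset.sum_add_distrib]
    refine Finset.sum_congr rfl fun a _ ↦ ?_
    rw [hp, smul_smul, smul_smul, ← add_smul, add_comm]
  have hsub : (Q - γ • Qe).PosSemidef := by
    rw [hQsub]
    exact (posSemidef_sum_smul_vecMulVec q hq0 emb).smul (sub_nonneg.2 hγ1)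
  have hQpd : Q.PosDef := by
    simpa using (hQepd.smul hγ0).add_posSemidef hsub
  have hbound (a : A) : γ * (emb a ⬝ᵥ (Q⁻¹ *ᵥ emb a)) ≤ Γ := by
    refine (hQepd.mul_dotProduct_inv_mulVec_le hQpd hγ0.le hsub (emb a)).trans ?_
    rw [hΓ]
    exact Finset.le_sup' (fun a : A => emb a ⬝ᵥ (Qe⁻¹ *ᵥ emb a)) (Finset.mem_univ a)
  have habs := hQpd.inv.posSemidef.abs_dotProduct_mulVec_le (emb x) (emb y)
  set t := |emb y ⬝ᵥ (Q⁻¹ *ᵥ emb x)|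
  have ht : γ * t ≤ Γ := by
    have := mul_le_mul_of_nonneg_left habs hγ0.le
    linarith [hbound x, hbound y]
  have hηB : 0 < η * B := mul_pos hη hB
  have hmain : η * B * t ≤ 1 := by
    refine le_of_mul_le_mul_left ?_ hγ0
    calc γ * (η * B * t) = η * B * (γ * t) := by ring
      _ ≤ η * B * Γ := mul_le_mul_of_nonneg_left ht hηB.le
      _ = γ * 1 := by rw [hγ, mul_one]
  calc η * |g * (emb y ⬝ᵥ (Q⁻¹ *ᵥ emb x))| = η * (|g| * t) := by rw [abs_mul]
    _ ≤ η * (B * t) := by gcongr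
    _ = η * B * t := by ring
    _ ≤ 1 := hmain
end

section
/- Let m ∈ ℝ, σ > 0, and c ∈ ℝ with c − m ≤ σ. Let μ be the Gaussian probability measure on ℝ with mean m and variance σ². Then μ({z ∈ ℝ : z > c}) ≥ 1/(4·e·√π), where e is Euler's number. -/
open ProbabilityTheory

/-- Within `√2` standard deviations of its mean, the Gaussian density is at least
`1 / (e √2 √π σ)`. -/
lemma gaussianPDFReal_ge_of_abs_sub_le {m σ x : ℝ} {v : NNReal} (hσ : 0 < σ)
    (hv : (v : ℝ) = σ ^ 2) (hx : |x - m| ≤ Real.sqrt 2 * σ) :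
    1 / (Real.exp 1 * Real.sqrt 2 * Real.sqrt Real.pi * σ) ≤
      gaussianPDFReal m v x := by
  have hsq : (x - m) ^ 2 ≤ 2 * σ ^ 2 := by
    have h := pow_le_pow_left₀ (abs_nonneg _) hx 2
    rwa [sq_abs, mul_pow, Real.sq_sqrt (by norm_num)] at h
  have hroot : Real.sqrt (2 * Real.pi * σ ^ 2) = Real.sqrt 2 * Real.sqrt Real.pi * σ := by
    rw [Real.sqrt_mul (by positivity), Real.sqrt_mul (by norm_num), Real.sqrt_sq hσ.le]
  have hexp : Real.exp (-1) ≤ Real.exp (-(x - m) ^ 2 / (2 * σ ^ 2)) := by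
    rw [Real.exp_le_exp, le_div_iff₀ (by positivity)]
    linarith
  simp only [gaussianPDFReal_def, hv]
  calc 1 / (Real.exp 1 * Real.sqrt 2 * Real.sqrt Real.pi * σ)
      = (Real.sqrt (2 * Real.pi * σ ^ 2))⁻¹ * Real.exp (-1) := by
        rw [hroot, Real.exp_neg]
        field_simp
    _ ≤ _ := by gcongr

/-- Gaussian anti-concentration: if `μ` is the Gaussian measure on `ℝ` with mean `m` and
variance `σ² > 0`, and `c - m ≤ σ`, then `μ {z | z > c} ≥ 1 / (4 e √π)`. -/
theorem stmt_14 (m σ c : ℝ) (hσ : 0 < σ) (hc : c - m ≤ σ) :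
    ENNReal.ofReal (1 / (4 * Real.exp 1 * Real.sqrt Real.pi)) ≤
      gaussianReal m (⟨σ ^ 2, sq_nonneg σ⟩ : NNReal) {z : ℝ | c < z} := by
  obtain ⟨v, hv⟩ : ∃ v : NNReal, v = ⟨σ ^ 2, sq_nonneg σ⟩ := ⟨_, rfl⟩
  rw [← hv]
  have hvσ : (v : ℝ) = σ ^ 2 := congrArg NNReal.toReal hv
  have hv0 : v ≠ 0 := by
    rw [← NNReal.coe_ne_zero, hvσ]
    positivity
  set d := 1 / (Real.exp 1 * Real.sqrt 2 * Real.sqrt Real.pi * σ) with hd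
  have hd0 : 0 ≤ d := by positivity
  set s := Set.Ioc (m + σ) (m + Real.sqrt 2 * σ) with hs
  have hsub : s ⊆ {z : ℝ | c < z} := fun z hz => by
    have := hz.1
    simp only [Set.mem_ofPred_eq]
    linarith
  have hroot : 4 / 3 ≤ Real.sqrt 2 := Real.le_sqrt_of_sq_le (by norm_num)
  have harea : 1 / (4 * Real.exp 1 * Real.sqrt Real.pi) ≤
      d * (m + Real.sqrt 2 * σ - (m + σ)) := by
    have heq : d * (m + Real.sqrt 2 * σ - (m + σ)) =
        (Real.sqrt 2 - 1) / (Real.exp 1 * Real.sqrt 2 * Real.sqrt Real.pi) := by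
      rw [hd]
      field_simp
      ring
    rw [heq, div_le_div_iff₀ (by positivity) (by positivity)]
    have hpos : 0 < Real.exp 1 * Real.sqrt Real.pi := by positivity
    nlinarith
  calc ENNReal.ofReal (1 / (4 * Real.exp 1 * Real.sqrt Real.pi))
      ≤ ENNReal.ofReal (d * (m + Real.sqrt 2 * σ - (m + σ))) := ENNReal.ofReal_le_ofReal harea
    _ = ∫⁻ _ in s, ENNReal.ofReal d := by
        rw [MeasureTheory.setLIntegral_const, hs, Real.volume_Ioc, ENNReal.ofReal_mul hd0]
    _ ≤ ∫⁻ x in s, gaussianPDF m v x := by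
        refine MeasureTheory.setLIntegral_mono (measurable_gaussianPDF _ _) fun x hx => ?_
        refine ENNReal.ofReal_le_ofReal (gaussianPDFReal_ge_of_abs_sub_le hσ hvσ ?_)
        rw [abs_of_nonneg (by linarith [hx.1])]
        linarith [hx.2]
    _ = gaussianReal m v s := (gaussianReal_apply m hv0 s).symm
    _ ≤ _ := MeasureTheory.measure_mono hsub
end

section
/- Let A be a finite nonempty set, D, T ∈ ℤ_{>0}, λ ≥ 1, ε ≥ 0, and x ↦ x̃ a map from A to ℝ^D with ‖x̃‖₂ ≤ 1 for all x ∈ A. Let θ ∈ ℝ^D and f : A → ℝ with |f(x) − ⟨θ, x̃⟩| ≤ ε for all x ∈ A. Let x₁, …, x_T ∈ A, define A_t := λ·1_D + Σ_{s=1}^{t} x̃_s x̃_sᵀ (so A₀ = λ·1_D) where x̃_s is the feature vector of x_s, and ψ_t := Σ_{s=1}^{t} ‖x̃_s‖_{A_{s−1}⁻¹}. Let θ̂₀, …, θ̂_{T−1} ∈ ℝ^D and 0 ≤ β₀ ≤ β₁ ≤ … ≤ β_{T−1} be given, and assume: (confidence) for every t ∈ {0,…,T−1} and every x ∈ A, |⟨x̃,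 θ̂_t⟩ − ⟨x̃, θ⟩| ≤ ‖x̃‖_{A_t⁻¹}·(β_t + ε·ψ_t); and (UCB selection) for every t ∈ {0,…,T−1}, x_{t+1} maximizes ⟨x̃, θ̂_t⟩ + ‖x̃‖_{A_t⁻¹}·(β_t + ε·ψ_t) over x ∈ A. Set S := Σ_{t=1}^{T} ‖x̃_t‖²_{A_{t−1}⁻¹}. Then Σ_{t=1}^{T} ( max_{x∈A} f(x) − f(x_t) ) ≤ 2·ε·T + 2·β_{T−1}·√T·√S + 2·ε·T·S. -/
open Matrix

/-- The Mahalanobis norm `‖v‖_M = sqrt (vᵀ M v)`. -/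
noncomputable def mahalanobisNorm {D : ℕ} (M : Matrix (Fin D) (Fin D) ℝ)
    (v : Fin D → ℝ) : ℝ :=
  Real.sqrt (v ⬝ᵥ (M *ᵥ v))

theorem mahalanobisNorm_nonneg {D : ℕ} (M : Matrix (Fin D) (Fin D) ℝ) (v : Fin D → ℝ) :
    0 ≤ mahalanobisNorm M v :=
  Real.sqrt_nonneg _

/-- Deterministic regret bound for the modified LinUCB algorithm in the misspecified
linear bandit problem (Proposition 1, on the confidence event):
`∑_{t=1}^T (max_x f(x) - f(x_t)) ≤ 2 ε T + 2 β_{T-1} √T √S + 2 ε T S`. -/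
theorem stmt_15 {A : Type*} [Fintype A] [Nonempty A] (D T : ℕ) (hD : 0 < D) (hT : 0 < T)
    (lam : ℝ) (hlam : 1 ≤ lam) (ε : ℝ) (hε : 0 ≤ ε)
    (emb : A → Fin D → ℝ) (hemb : ∀ x, ∑ i, (emb x i) ^ 2 ≤ 1)
    (θ : Fin D → ℝ) (f : A → ℝ) (hf : ∀ x, |f x - θ ⬝ᵥ emb x| ≤ ε)
    (xs : ℕ → A)
    (Amat : ℕ → Matrix (Fin D) (Fin D) ℝ)
    (hAmat : ∀ t, Amat t = lam • (1 : Matrix (Fin D) (Fin D) ℝ) +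
      ∑ s ∈ Finset.Icc 1 t, vecMulVec (emb (xs s)) (emb (xs s)))
    (ψ : ℕ → ℝ)
    (hψ : ∀ t, ψ t = ∑ s ∈ Finset.Icc 1 t, mahalanobisNorm (Amat (s - 1))⁻¹ (emb (xs s)))
    (θhat : ℕ → Fin D → ℝ) (β : ℕ → ℝ)
    (hβ0 : 0 ≤ β 0) (hβmono : ∀ s t', s ≤ t' → t' ≤ T - 1 → β s ≤ β t')
    (hconf : ∀ t < T, ∀ x : A,
      |emb x ⬝ᵥ θhat t - emb x ⬝ᵥ θ| ≤
        mahalanobisNorm (Amat t)⁻¹ (emb x) * (β t + ε * ψ t))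
    (hsel : ∀ t < T, ∀ x : A,
      emb x ⬝ᵥ θhat t + mahalanobisNorm (Amat t)⁻¹ (emb x) * (β t + ε * ψ t) ≤
        emb (xs (t + 1)) ⬝ᵥ θhat t +
          mahalanobisNorm (Amat t)⁻¹ (emb (xs (t + 1))) * (β t + ε * ψ t))
    (S : ℝ)
    (hS : S = ∑ t ∈ Finset.Icc 1 T, (mahalanobisNorm (Amat (t - 1))⁻¹ (emb (xs t))) ^ 2) :
    ∑ t ∈ Finset.Icc 1 T, (Finset.univ.sup' Finset.univ_nonempty f - f (xs t)) ≤
      2 * ε * T + 2 * β (T - 1) * Real.sqrt T * Real.sqrt S + 2 * ε * T * S := by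
  set w : ℕ → ℝ := fun s => mahalanobisNorm (Amat (s - 1))⁻¹ (emb (xs s)) with hw
  have hw0 : ∀ s, 0 ≤ w s := fun s => mahalanobisNorm_nonneg _ _
  set W : ℝ := ∑ s ∈ Finset.Icc 1 T, w s with hW
  have hW0 : 0 ≤ W := Finset.sum_nonneg fun s _ => hw0 s
  have hWsq : W ^ 2 ≤ T * S := by
    have h := sq_sum_le_card_mul_sum_sq (s := Finset.Icc 1 T) (f := w)
    rw [Nat.card_Icc, Nat.add_sub_cancel] at h
    rw [hS]
    exact h
  have hWle : W ≤ Real.sqrt T * Real.sqrt S := by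
    rw [← Real.sqrt_mul (Nat.cast_nonneg T)]
    exact Real.le_sqrt_of_sq_le hWsq
  have hβT : 0 ≤ β (T - 1) := hβ0.trans (hβmono 0 (T - 1) (Nat.zero_le _) le_rfl)
  have hround : ∀ t ∈ Finset.Icc 1 T, Finset.univ.sup' Finset.univ_nonempty f - f (xs t) ≤
      2 * ε + 2 * (β (T - 1) + ε * W) * w t := by
    intro t ht
    obtain ⟨ht1, htT⟩ := Finset.mem_Icc.mp ht
    have hlt : t - 1 < T := by omega
    have hψW : ψ (t - 1) ≤ W := by
      rw [hψ]
      exact Finset.sum_le_sum_of_subset_of_nonneg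
        (Finset.Icc_subset_Icc_right hlt.le) fun s _ _ => hw0 s
    have hbonus : w t * (β (t - 1) + ε * ψ (t - 1)) ≤ w t * (β (T - 1) + ε * W) :=
      mul_le_mul_of_nonneg_left
        (add_le_add (hβmono _ _ (by omega) le_rfl) (mul_le_mul_of_nonneg_left hψW hε)) (hw0 t)
    obtain ⟨x, -, hx⟩ := Finset.exists_mem_eq_sup' Finset.univ_nonempty f
    have hsel_x := hsel (t - 1) hlt x
    rw [Nat.sub_add_cancel ht1] at hsel_x
    have hconf_x := (abs_le.mp (hconf (t - 1) hlt x)).1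
    have hconf_t := (abs_le.mp (hconf (t - 1) hlt (xs t))).2
    have hf_x := (abs_le.mp (hf x)).2
    have hf_t := (abs_le.mp (hf (xs t))).1
    rw [dotProduct_comm] at hf_x hf_t
    rw [hx]
    simp only [hw] at hbonus ⊢
    linarith
  calc ∑ t ∈ Finset.Icc 1 T, (Finset.univ.sup' Finset.univ_nonempty f - f (xs t))
      ≤ ∑ t ∈ Finset.Icc 1 T, (2 * ε + 2 * (β (T - 1) + ε * W) * w t) :=
        Finset.sum_le_sum hround
    _ = 2 * ε * T + 2 * β (T - 1) * W + 2 * ε * W ^ 2 := by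
        rw [Finset.sum_add_distrib, ← Finset.mul_sum _ w, ← hW, Finset.sum_const, Nat.card_Icc,
          Nat.add_sub_cancel, nsmul_eq_mul]
        ring
    _ ≤ 2 * ε * T + 2 * β (T - 1) * (Real.sqrt T * Real.sqrt S) + 2 * ε * (T * S) := by
        gcongr
    _ = 2 * ε * T + 2 * β (T - 1) * Real.sqrt T * Real.sqrt S + 2 * ε * T * S := by
        ring
end

section
/- Let D, t ∈ ℤ_{>0}, λ > 0, θ ∈ ℝ^D, ε ≥ 0, vectors x̃₁, …, x̃_t ∈ ℝ^D, reals ω₁, …, ω_t with |ω_s| ≤ ε for all s, and reals ε₁, …, ε_t. Define y_s := ⟨θ, x̃_s⟩ + ω_s + ε_s, A_s := λ·1_D + Σ_{r=1}^{s} x̃_r x̃_rᵀ (so A₀ = λ·1_D), and θ̂_t := A_t⁻¹ · Σ_{s=1}^{t} y_s x̃_s. Then for every v ∈ ℝ^D: |⟨v, θ̂_t⟩ − ⟨v, θ⟩| ≤ ‖v‖_{A_t⁻¹} · ( ‖Σ_{s=1}^{t} ε_s x̃_s‖_{A_t⁻¹} + √λ·‖θ‖₂ + ε·Σ_{s=1}^{t}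 ‖x̃_s‖_{A_{s−1}⁻¹} ). -/
open Matrix

/-- Cauchy–Schwarz for the semi-inner product defined by a positive semidefinite matrix. -/
lemma abs_dotProduct_mulVec_le_mahalanobisNorm {D : ℕ} {M : Matrix (Fin D) (Fin D) ℝ}
    (hM : M.PosSemidef) (v u : Fin D → ℝ) :
    |v ⬝ᵥ (M *ᵥ u)| ≤ mahalanobisNorm M v * mahalanobisNorm M u := by
  have nonneg (w : Fin D → ℝ) : 0 ≤ w ⬝ᵥ (M *ᵥ w) := by
    simpa using hM.dotProduct_mulVec_nonneg w
  have hsymm : u ⬝ᵥ (M *ᵥ v) = v ⬝ᵥ (M *ᵥ u) := by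
    have hT : Mᵀ = M := by simpa using hM.isHermitian.eq
    rw [dotProduct_mulVec, ← mulVec_transpose, hT, dotProduct_comm]
  have hquad (c : ℝ) : 0 ≤ (v ⬝ᵥ (M *ᵥ v)) * (c * c) + 2 * (v ⬝ᵥ (M *ᵥ u)) * c +
      u ⬝ᵥ (M *ᵥ u) := by
    have h := nonneg (c • v + u)
    simp only [mulVec_add, mulVec_smul, dotProduct_add, add_dotProduct, smul_dotProduct,
      dotProduct_smul, smul_eq_mul, hsymm] at h
    linarith
  have hdisc := discrim_le_zero hquad
  unfold mahalanobisNorm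
  rw [← Real.sqrt_mul (nonneg v)]
  apply Real.abs_le_sqrt
  unfold discrim at hdisc
  nlinarith

/-- Inversion of positive definite matrices is antitone in the Loewner order. -/
lemma mahalanobisNorm_inv_anti {D : ℕ} {A B : Matrix (Fin D) (Fin D) ℝ}
    (hA : A.PosDef) (hB : B.PosDef) (hAB : (B - A).PosSemidef) (x : Fin D → ℝ) :
    mahalanobisNorm B⁻¹ x ≤ mahalanobisNorm A⁻¹ x := by
  apply Real.sqrt_le_sqrt
  have hAinv : A *ᵥ (A⁻¹ *ᵥ x) = x := by
    rw [mulVec_mulVec, mul_nonsing_inv _ ((isUnit_iff_isUnit_det A).mp hA.isUnit), one_mulVec]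
  have hBinv : B *ᵥ (B⁻¹ *ᵥ x) = x := by
    rw [mulVec_mulVec, mul_nonsing_inv _ ((isUnit_iff_isUnit_det B).mp hB.isUnit), one_mulVec]
  set w := A⁻¹ *ᵥ x
  set u := B⁻¹ *ᵥ x
  have hT : Aᵀ = A := by simpa using hA.isHermitian.eq
  have hcross : w ⬝ᵥ (A *ᵥ u) = x ⬝ᵥ u := by
    rw [dotProduct_mulVec, ← mulVec_transpose, hT, hAinv]
  have h1 : 0 ≤ (w - u) ⬝ᵥ (A *ᵥ (w - u)) := by
    simpa using hA.posSemidef.dotProduct_mulVec_nonneg (w - u)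
  have h2 : 0 ≤ u ⬝ᵥ ((B - A) *ᵥ u) := by
    simpa using hAB.dotProduct_mulVec_nonneg u
  simp only [mulVec_sub, sub_mulVec, dotProduct_sub, sub_dotProduct, hAinv, hBinv, hcross] at h1 h2
  rw [dotProduct_comm w x, dotProduct_comm u x] at h1
  rw [dotProduct_comm u x] at h2
  linarith

lemma mahalanobisNorm_smul_one_inv {D : ℕ} {c : ℝ} (hc : 0 < c) (v : Fin D → ℝ) :
    c * mahalanobisNorm (c • (1 : Matrix (Fin D) (Fin D) ℝ))⁻¹ v =
      Real.sqrt c * Real.sqrt (∑ i, (v i) ^ 2) := by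
  have hinv : (c • (1 : Matrix (Fin D) (Fin D) ℝ))⁻¹ = c⁻¹ • 1 := by
    apply inv_eq_right_inv
    simp [hc.ne']
  have hsum : v ⬝ᵥ v = ∑ i, (v i) ^ 2 := by simp [dotProduct, sq]
  rw [mahalanobisNorm, hinv, smul_mulVec, one_mulVec, dotProduct_smul, smul_eq_mul, hsum,
    Real.sqrt_mul (inv_nonneg.mpr hc.le), Real.sqrt_inv, ← mul_assoc, ← div_eq_mul_inv,
    Real.div_sqrt]

/-- Deterministic confidence decomposition for regularized least squares with a biased
(misspecified) noise term `ω` and stochastic noise `ε_s`: for every direction `v`,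
`|⟨v, θ̂_t⟩ - ⟨v, θ⟩| ≤ ‖v‖_{A_t⁻¹} (‖∑_s ε_s x̃_s‖_{A_t⁻¹} + √λ ‖θ‖₂ + ε ∑_s ‖x̃_s‖_{A_{s-1}⁻¹})`. -/
theorem stmt_16 (D t : ℕ) (hD : 0 < D) (ht : 0 < t) (lam : ℝ) (hlam : 0 < lam)
    (θ : Fin D → ℝ) (ε : ℝ) (hε : 0 ≤ ε)
    (xt : ℕ → Fin D → ℝ)
    (ω : ℕ → ℝ) (hω : ∀ s, |ω s| ≤ ε)
    (noise : ℕ → ℝ)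
    (y : ℕ → ℝ) (hy : ∀ s, y s = θ ⬝ᵥ xt s + ω s + noise s)
    (Amat : ℕ → Matrix (Fin D) (Fin D) ℝ)
    (hAmat : ∀ s, Amat s = lam • (1 : Matrix (Fin D) (Fin D) ℝ) +
      ∑ r ∈ Finset.Icc 1 s, vecMulVec (xt r) (xt r))
    (θhat : Fin D → ℝ)
    (hθhat : θhat = (Amat t)⁻¹ *ᵥ (∑ s ∈ Finset.Icc 1 t, y s • xt s)) :
    ∀ v : Fin D → ℝ, |v ⬝ᵥ θhat - v ⬝ᵥ θ| ≤
      mahalanobisNorm (Amat t)⁻¹ v *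
        (mahalanobisNorm (Amat t)⁻¹ (∑ s ∈ Finset.Icc 1 t, noise s • xt s) +
          Real.sqrt lam * Real.sqrt (∑ i, (θ i) ^ 2) +
          ε * ∑ s ∈ Finset.Icc 1 t, mahalanobisNorm (Amat (s - 1))⁻¹ (xt s)) := by
  intro v
  have hpsd (S : Finset ℕ) : (∑ r ∈ S, vecMulVec (xt r) (xt r)).PosSemidef :=
    posSemidef_sum S fun r _ => by simpa using posSemidef_vecMulVec_self_star (xt r)
  have hpd (s : ℕ) : (Amat s).PosDef := by
    rw [hAmat s]
    exact (PosDef.one.smul hlam).add_posSemidef (hpsd _)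
  have hmono {s s' : ℕ} (h : s ≤ s') : (Amat s' - Amat s).PosSemidef := by
    have hsub : Finset.Icc 1 s ⊆ Finset.Icc 1 s' := Finset.Icc_subset_Icc_right h
    rw [hAmat s, hAmat s', add_sub_add_left_eq_sub, ← Finset.sum_sdiff hsub,
      add_sub_cancel_right]
    exact hpsd _
  have hM : (Amat t)⁻¹.PosSemidef := (hpd t).posSemidef.inv
  have hy_sum : ∑ s ∈ Finset.Icc 1 t, y s • xt s =
      Amat t *ᵥ θ + (∑ s ∈ Finset.Icc 1 t, noise s • xt s +
        ∑ s ∈ Finset.Icc 1 t, ω s • xt s - lam • θ) := by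
    have hmul : Amat t *ᵥ θ = lam • θ + ∑ s ∈ Finset.Icc 1 t, (θ ⬝ᵥ xt s) • xt s := by
      rw [hAmat t, add_mulVec, smul_mulVec, one_mulVec, sum_mulVec]
      simp [vecMulVec_mulVec, dotProduct_comm]
    rw [hmul]
    simp only [hy, add_smul, Finset.sum_add_distrib]
    abel
  have hdiff : v ⬝ᵥ θhat - v ⬝ᵥ θ =
      v ⬝ᵥ ((Amat t)⁻¹ *ᵥ ∑ s ∈ Finset.Icc 1 t, noise s • xt s) +
        ∑ s ∈ Finset.Icc 1 t, ω s * (v ⬝ᵥ ((Amat t)⁻¹ *ᵥ xt s)) -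
        lam * (v ⬝ᵥ ((Amat t)⁻¹ *ᵥ θ)) := by
    rw [hθhat, hy_sum, mulVec_add, mulVec_mulVec,
      nonsing_inv_mul _ ((isUnit_iff_isUnit_det _).mp (hpd t).isUnit), one_mulVec, mulVec_sub,
      mulVec_add, mulVec_smul, mulVec_sum (Amat t)⁻¹ (Finset.Icc 1 t) fun s => ω s • xt s]
    simp only [dotProduct_add, dotProduct_sub, dotProduct_smul, dotProduct_sum, mulVec_smul,
      smul_eq_mul]
    ring
  have hv : 0 ≤ mahalanobisNorm (Amat t)⁻¹ v := Real.sqrt_nonneg _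
  have hnoise := abs_dotProduct_mulVec_le_mahalanobisNorm hM v
    (∑ s ∈ Finset.Icc 1 t, noise s • xt s)
  have hbias : |∑ s ∈ Finset.Icc 1 t, ω s * (v ⬝ᵥ ((Amat t)⁻¹ *ᵥ xt s))| ≤
      mahalanobisNorm (Amat t)⁻¹ v *
        (ε * ∑ s ∈ Finset.Icc 1 t, mahalanobisNorm (Amat (s - 1))⁻¹ (xt s)) := by
    rw [Finset.mul_sum, Finset.mul_sum]
    refine (Finset.abs_sum_le_sum_abs _ _).trans (Finset.sum_le_sum fun s hs => ?_)
    have hst : s - 1 ≤ t := (Nat.sub_le s 1).trans (Finset.mem_Icc.mp hs).2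
    rw [abs_mul, mul_left_comm]
    exact mul_le_mul (hω s) ((abs_dotProduct_mulVec_le_mahalanobisNorm hM v (xt s)).trans
      (mul_le_mul_of_nonneg_left
        (mahalanobisNorm_inv_anti (hpd _) (hpd t) (hmono hst) (xt s)) hv)) (abs_nonneg _) hε
  have hreg : |lam * (v ⬝ᵥ ((Amat t)⁻¹ *ᵥ θ))| ≤
      mahalanobisNorm (Amat t)⁻¹ v * (Real.sqrt lam * Real.sqrt (∑ i, (θ i) ^ 2)) := by
    have hA0 : Amat 0 = lam • 1 := by simp [hAmat 0]
    rw [abs_mul, abs_of_pos hlam, ← mahalanobisNorm_smul_one_inv hlam θ, ← hA0, mul_left_comm]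
    exact mul_le_mul_of_nonneg_left ((abs_dotProduct_mulVec_le_mahalanobisNorm hM v θ).trans
      (mul_le_mul_of_nonneg_left
        (mahalanobisNorm_inv_anti (hpd 0) (hpd t) (hmono t.zero_le) θ) hv)) hlam.le
  rw [hdiff, mul_add, mul_add]
  refine (abs_sub _ _).trans ?_
  linarith [abs_add_le (v ⬝ᵥ ((Amat t)⁻¹ *ᵥ ∑ s ∈ Finset.Icc 1 t, noise s • xt s))
    (∑ s ∈ Finset.Icc 1 t, ω s * (v ⬝ᵥ ((Amat t)⁻¹ *ᵥ xt s)))]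
end

section
/- Let D, T ∈ ℤ_{>0}, λ ≥ 1, and let x̃₁, …, x̃_T ∈ ℝ^D with ‖x̃_t‖₂ ≤ 1 for all t. Define A_t := λ·1_D + Σ_{s=1}^{t} x̃_s x̃_sᵀ (so A₀ = λ·1_D). Then Σ_{t=1}^{T} ‖x̃_t‖²_{A_{t−1}⁻¹} ≤ 2·log det(λ⁻¹·A_T) ≤ 2·D·log(1 + T/(λ·D)). -/
open Matrix

open Finset

/-- The matrix determinant lemma for a symmetric rank-one update. -/
lemma det_add_vecMulVec_self {n : Type*} [Fintype n] [DecidableEq n] {A : Matrix n n ℝ}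
    (hA : IsUnit A.det) (v : n → ℝ) :
    (A + vecMulVec v v).det = A.det * (1 + v ⬝ᵥ (A⁻¹ *ᵥ v)) := by
  rw [vecMulVec_eq Unit, det_add_replicateCol_mul_replicateRow hA, Matrix.mul_assoc,
    ← replicateCol_mulVec]
  simp [det_unique, Matrix.mul_apply, dotProduct]

/-- If `A` dominates the identity and `v` lies in the unit ball, then `vᵀ A⁻¹ v ≤ 1`. -/
lemma dotProduct_inv_mulVec_le_one {n : Type*} [Fintype n] [DecidableEq n] {A : Matrix n n ℝ}
    (hA : IsUnit A.det) (hge : ∀ y : n → ℝ, y ⬝ᵥ y ≤ y ⬝ᵥ (A *ᵥ y)) {v : n → ℝ}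
    (hv : ∑ i, v i ^ 2 ≤ 1) : v ⬝ᵥ (A⁻¹ *ᵥ v) ≤ 1 := by
  have hAy : A *ᵥ (A⁻¹ *ᵥ v) = v := by
    rw [mulVec_mulVec, mul_nonsing_inv _ hA, one_mulVec]
  have hle := hge (A⁻¹ *ᵥ v)
  rw [hAy, dotProduct_comm _ v] at hle
  have hcs : (v ⬝ᵥ (A⁻¹ *ᵥ v)) ^ 2 ≤ (∑ i, v i ^ 2) * ∑ i, (A⁻¹ *ᵥ v) i ^ 2 :=
    sum_mul_sq_le_sq_mul_sq _ _ _
  have hsq : ∑ i, (A⁻¹ *ᵥ v) i ^ 2 = (A⁻¹ *ᵥ v) ⬝ᵥ (A⁻¹ *ᵥ v) := by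
    simp only [dotProduct, sq]
  have h0 : 0 ≤ ∑ i, (A⁻¹ *ᵥ v) i ^ 2 := sum_nonneg fun _ _ => sq_nonneg _
  nlinarith

lemma le_two_mul_log_one_add {u : ℝ} (h0 : 0 ≤ u) (h1 : u ≤ 1) :
    u ≤ 2 * Real.log (1 + u) := by
  have h := Real.one_sub_inv_le_log_of_pos (show 0 < 1 + u by linarith)
  have h2 : u / 2 ≤ 1 - (1 + u)⁻¹ := by
    rw [show 1 - (1 + u)⁻¹ = u / (1 + u) by field_simp; ring]
    exact div_le_div_of_nonneg_left h0 (by linarith) (by linarith)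
  linarith

/-- The AM-GM inequality for the eigenvalues of a positive definite matrix, in logarithmic form. -/
lemma Matrix.PosDef.log_det_le {n : Type*} [Fintype n] [DecidableEq n] {B : Matrix n n ℝ}
    (hB : B.PosDef) {c : ℝ} (hc : 0 < c) (htr : B.trace ≤ Fintype.card n * c) :
    Real.log B.det ≤ Fintype.card n * Real.log c := by
  have hdet : B.det = ∏ i, hB.1.eigenvalues i := by
    simpa using hB.1.det_eq_prod_eigenvalues
  have htrace : B.trace = ∑ i, hB.1.eigenvalues i := by
    simpa using hB.1.trace_eq_sum_eigenvalues
  rw [hdet, Real.log_prod fun i _ => (hB.eigenvalues_pos i).ne']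
  have key : ∀ i, Real.log (hB.1.eigenvalues i) ≤ hB.1.eigenvalues i / c - 1 + Real.log c := by
    intro i
    have hi := hB.eigenvalues_pos i
    have h := Real.log_le_sub_one_of_pos (div_pos hi hc)
    rw [Real.log_div hi.ne' hc.ne'] at h
    linarith
  calc ∑ i, Real.log (hB.1.eigenvalues i)
      ≤ ∑ i, (hB.1.eigenvalues i / c - 1 + Real.log c) := sum_le_sum fun i _ => key i
    _ = B.trace / c - Fintype.card n + Fintype.card n * Real.log c := by
        rw [sum_add_distrib, sum_sub_distrib, ← sum_div, ← htrace]
        simp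
    _ ≤ Fintype.card n * Real.log c := by
        have := (div_le_iff₀ hc).2 htr
        linarith

/-- Elliptical potential lemma: with `A_t = λ 1_D + ∑_{s=1}^t x̃_s x̃_sᵀ`, `λ ≥ 1`, and
`‖x̃_t‖₂ ≤ 1`, one has
`∑_{t=1}^T ‖x̃_t‖²_{A_{t-1}⁻¹} ≤ 2 log det (λ⁻¹ A_T) ≤ 2 D log (1 + T/(λ D))`. -/
theorem stmt_17 (D T : ℕ) (hD : 0 < D) (hT : 0 < T) (lam : ℝ) (hlam : 1 ≤ lam)
    (xt : ℕ → Fin D → ℝ) (hx : ∀ t, ∑ i, (xt t i) ^ 2 ≤ 1)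
    (Amat : ℕ → Matrix (Fin D) (Fin D) ℝ)
    (hAmat : ∀ t, Amat t = lam • (1 : Matrix (Fin D) (Fin D) ℝ) +
      ∑ s ∈ Finset.Icc 1 t, vecMulVec (xt s) (xt s)) :
    (∑ t ∈ Finset.Icc 1 T, (mahalanobisNorm (Amat (t - 1))⁻¹ (xt t)) ^ 2 ≤
        2 * Real.log ((lam⁻¹ • Amat T).det)) ∧
      2 * Real.log ((lam⁻¹ • Amat T).det) ≤
        2 * D * Real.log (1 + T / (lam * D)) := by
  have hl : 0 < lam := by linarith
  have hpsd (t : ℕ) : (∑ s ∈ Finset.Icc 1 t, vecMulVec (xt s) (xt s)).PosSemidef :=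
    posSemidef_sum _ fun s _ => by simpa using posSemidef_vecMulVec_self_star (xt s)
  have hpd (t : ℕ) : (Amat t).PosDef := by
    rw [hAmat]
    exact (PosDef.one.smul hl).add_posSemidef (hpsd t)
  have hunit (t : ℕ) : IsUnit (Amat t).det := (hpd t).det_pos.ne'.isUnit
  have hge (t : ℕ) (y : Fin D → ℝ) : y ⬝ᵥ y ≤ y ⬝ᵥ (Amat t *ᵥ y) := by
    have h1 : 0 ≤ y ⬝ᵥ ((∑ s ∈ Finset.Icc 1 t, vecMulVec (xt s) (xt s)) *ᵥ y) := by
      simpa using (hpsd t).dotProduct_mulVec_nonneg y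
    have h2 : 0 ≤ y ⬝ᵥ y := by simpa using dotProduct_star_self_nonneg y
    rw [hAmat, add_mulVec, dotProduct_add, smul_mulVec, one_mulVec, dotProduct_smul, smul_eq_mul]
    nlinarith
  have hsucc (t : ℕ) : Amat (t + 1) = Amat t + vecMulVec (xt (t + 1)) (xt (t + 1)) := by
    rw [hAmat, hAmat, sum_Icc_succ_top (by omega), add_assoc]
  have hscaled (t : ℕ) : (lam⁻¹ • Amat t).PosDef := (hpd t).smul (inv_pos.2 hl)
  constructor
  · clear hT
    induction T with
    | zero => simp [hAmat, smul_smul, hl.ne']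
    | succ t ih =>
      have hnn : 0 ≤ xt (t + 1) ⬝ᵥ ((Amat t)⁻¹ *ᵥ xt (t + 1)) := by
        simpa using (hpd t).inv.posSemidef.dotProduct_mulVec_nonneg (xt (t + 1))
      have hlog := le_two_mul_log_one_add hnn
        (dotProduct_inv_mulVec_le_one (hunit t) (hge t) (hx (t + 1)))
      have hdet : (lam⁻¹ • Amat (t + 1)).det = (lam⁻¹ • Amat t).det *
          (1 + xt (t + 1) ⬝ᵥ ((Amat t)⁻¹ *ᵥ xt (t + 1))) := by
        rw [det_smul, det_smul, hsucc, det_add_vecMulVec_self (hunit t), mul_assoc]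
      rw [sum_Icc_succ_top (by omega), hdet,
        Real.log_mul (hscaled t).det_pos.ne' (by positivity), Nat.add_sub_cancel,
        mahalanobisNorm, Real.sq_sqrt hnn]
      linarith
  · have hDpos : (0 : ℝ) < D := by exact_mod_cast hD
    have htr : (Amat T).trace ≤ lam * D + T := by
      have h : ∑ s ∈ Finset.Icc 1 T, (vecMulVec (xt s) (xt s)).trace ≤
          ∑ s ∈ Finset.Icc 1 T, (1 : ℝ) := by
        refine sum_le_sum fun s _ => ?_
        rw [trace_vecMulVec]
        simpa only [dotProduct, sq] using hx s
      rw [hAmat, trace_add, trace_smul, trace_one, trace_sum, smul_eq_mul, Fintype.card_fin]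
      simpa using h
    have hlog := (hscaled T).log_det_le (c := 1 + T / (lam * D)) (by positivity) (by
      rw [trace_smul, smul_eq_mul, Fintype.card_fin]
      calc lam⁻¹ * (Amat T).trace ≤ lam⁻¹ * (lam * D + T) := by gcongr
        _ = D * (1 + T / (lam * D)) := by field_simp)
    rw [Fintype.card_fin] at hlog
    linarith
end
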